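/- arXiv:2011.04327 — 8 statements merged into one kernel-verified Lean document; each statement's English description precedes it below -/
import Mathlib

section
/- Let n and k be integers with n ≥ 3 and 0 < k ≤ n/2. If gcd(n,k) ≥ 5, then the accordion graph A[n,k] does not have the PMH-property. -/
open SimpleGraph

/-- The accordion graph `A[n,k]`: vertices `u_i = (false, i)` and `v_i = (true, i)`
for `i : ZMod n`, with edges `u_i u_{i+1}`, `v_i v_{i+1}`, `u_i v_i`, `u_i v_{i+k}`. -/
def accordion (n k : ℕ) : SimpleGraph (Bool × ZMod n) :=
  SimpleGraph.fromRel (fun x y =>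
    (x.1 = y.1 ∧ y.2 = x.2 + 1) ∨
    (x.1 = false ∧ y.1 = true ∧ (y.2 = x.2 ∨ y.2 = x.2 + (k : ZMod n))))

/-- A graph `G` has the PMH-property if every perfect matching `M` of `G` extends to a
Hamiltonian cycle of `G`, i.e. there is a perfect matching `N` of `G` such that `M ∪ N`
is the edge set of a Hamiltonian cycle of `G`. -/
def IsPMH {V : Type} [DecidableEq V] (G : SimpleGraph V) : Prop :=
  ∀ M : G.Subgraph, M.IsPerfectMatching →
    ∃ N : G.Subgraph, N.IsPerfectMatching ∧
      ∃ (v : V) (c : G.Walk v v), c.IsHamiltonianCycle ∧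
        {e | e ∈ c.edges} = M.edgeSet ∪ N.edgeSet

/-- Indicators of the edges of a perfect matching of a twisted toroidal grid with `g` columns,
each of them with rows indexed by two copies of `L`. In column `j`, `p b j` and `q b j` indicate the
two kinds of edges inside the column, and `x b j`, `y b j` the edges to the next column.
The matching avoids the edges joining columns `0` and `1`, the `p`-edges of the
even columns `j ≥ 2` and the `q`-edges of the odd columns `j ≥ 3`. -/
structure IsGridMatching {L : Type*} [AddCommGroup L] (g : ℕ) (k e : L)
    (p q x y : L → ℕ → ℤ) : Prop where
  p_nonneg : ∀ b j, 0 ≤ p b j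
  q_nonneg : ∀ b j, 0 ≤ q b j
  x_nonneg : ∀ b j, 0 ≤ x b j
  y_nonneg : ∀ b j, 0 ≤ y b j
  u_succ : ∀ b j, j + 1 < g → p b (j + 1) + q b (j + 1) + x b (j + 1) + x b j = 1
  v_succ : ∀ b j, j + 1 < g → p b (j + 1) + q (b - k) (j + 1) + y b (j + 1) + y b j = 1
  u_zero : ∀ b, p (b + e) 0 + q (b + e) 0 + x b (g - 1) = 1
  v_zero : ∀ b, p (b + e) 0 + q (b + e - k) 0 + y b (g - 1) = 1
  x_zero : ∀ b, x b 0 = 0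
  y_zero : ∀ b, y b 0 = 0
  p_even : ∀ b j, 2 ≤ j → j < g → Even j → p b j = 0
  q_odd : ∀ b j, 2 ≤ j → j < g → ¬ Even j → q b j = 0

/-- A vertex predicate of the twisted grid that is constant along the edges of a matching given by
its indicators, and along the edges of the matching it avoids. -/
structure IsEdgeInvariant {L : Type*} [AddCommGroup L] (g : ℕ) (k e : L)
    (p q x y : L → ℕ → ℤ) (P : Bool → L → ℕ → Prop) : Prop where
  rung : ∀ t b, P t b 0 ↔ P t b 1
  even : ∀ b j, 2 ≤ j → j < g → Even j → (P false b j ↔ P true b j)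
  odd : ∀ b j, 2 ≤ j → j < g → ¬ Even j → (P false b j ↔ P true (b + k) j)
  of_p : ∀ b j, j < g → p b j = 1 → (P false b j ↔ P true b j)
  of_q : ∀ b j, j < g → q b j = 1 → (P false b j ↔ P true (b + k) j)
  of_x : ∀ b j, j + 1 < g → x b j = 1 → (P false b j ↔ P false b (j + 1))
  of_y : ∀ b j, j + 1 < g → y b j = 1 → (P true b j ↔ P true b (j + 1))
  of_x_last : ∀ b, x b (g - 1) = 1 → (P false b (g - 1) ↔ P false (b + e) 0)
  of_y_last : ∀ b, y b (g - 1) = 1 → (P true b (g - 1) ↔ P true (b + e) 0)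

/-- The height of the face to the right of the `p`-edge `b` of column `j`. -/
def pHeight {L : Type*} (p : L → ℕ → ℤ) (b : L) : ℕ → ℤ
  | 0 => 0
  | 1 => p b 1
  | j + 2 => pHeight p b (j + 1) + if Even j then 1 else p b (j + 2)

/-- The height of the face to the right of the `q`-edge `b` of column `j`. -/
def qHeight {L : Type*} (q : L → ℕ → ℤ) (b : L) : ℕ → ℤ
  | 0 => 1
  | 1 => 1 - q b 1
  | j + 2 => qHeight q b (j + 1) + if Even j then q b (j + 2) else 1

/-- The height of the lower side of the level curve through a vertex. -/
def level {L : Type*} [AddCommGroup L] (k : L) (p q : L → ℕ → ℤ) (t : Bool) (b : L) (j : ℕ) : ℤ :=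
  if Even j then pHeight p b (j - 1) else qHeight q (if t then b - k else b) (j - 1)

namespace IsGridMatching

variable {L : Type*} [AddCommGroup L] {g : ℕ} {k e : L} {p q x y : L → ℕ → ℤ}

theorem qHeight_eq (h : IsGridMatching g k e p q x y) (b : L) (j : ℕ) (hj : j + 1 < g) :
    qHeight q b (j + 1) = pHeight p b (j + 1) + (if Even j then 1 else -1) * x b (j + 1) ∧
    qHeight q (b - k) (j + 1) = pHeight p b (j + 1) + (if Even j then 1 else -1) * y b (j + 1) := by
  induction j with
  | zero =>
    have := h.u_succ b 0 hj
    have := h.v_succ b 0 hj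
    have := h.x_zero b
    have := h.y_zero b
    simp only [zero_add, qHeight, pHeight, Even.zero, if_true] at *
    constructor <;> linarith
  | succ j ih =>
    obtain ⟨h1, h2⟩ := ih (by omega)
    have hu := h.u_succ b (j + 1) hj
    have hv := h.v_succ b (j + 1) hj
    by_cases hE : Even j
    · have hp := h.p_even b (j + 2) (by omega) hj (by grind)
      have hE' : ¬ Even (j + 1) := by grind
      simp only [qHeight, pHeight, hE, hE', if_true, if_false] at *
      constructor <;> linarith
    · have hq := h.q_odd b (j + 2) (by omega) hj (by grind)
      have hq' := h.q_odd (b - k) (j + 2) (by omega) hj (by grind)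
      have hE' : Even (j + 1) := by grind
      simp only [qHeight, pHeight, hE, hE', if_true, if_false] at *
      constructor <;> linarith

theorem pHeight_mono (h : IsGridMatching g k e p q x y) (b : L) :
    Monotone fun j => pHeight p b (j + 1) := by
  refine monotone_nat_of_le_succ fun j => ?_
  have := h.p_nonneg b (j + 2)
  simp only [pHeight]
  split_ifs <;> linarith

theorem qHeight_mono (h : IsGridMatching g k e p q x y) (b : L) :
    Monotone fun j => qHeight q b (j + 1) := by
  refine monotone_nat_of_le_succ fun j => ?_
  have := h.q_nonneg b (j + 2)
  simp only [qHeight]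
  split_ifs <;> linarith

theorem level_of_p (h : IsGridMatching g k e p q x y) (b : L) (j : ℕ) (hj : j + 2 < g)
    (hp : p b (j + 2) = 1) : level k p q false b (j + 2) = level k p q true b (j + 2) := by
  have h1 := h.qHeight_eq b j (by omega)
  have hu := h.u_succ b (j + 1) hj
  have hv := h.v_succ b (j + 1) hj
  have := h.x_nonneg b (j + 1)
  have := h.x_nonneg b (j + 2)
  have := h.y_nonneg b (j + 1)
  have := h.y_nonneg b (j + 2)
  have := h.q_nonneg b (j + 2)
  have := h.q_nonneg (b - k) (j + 2)
  have hx : x b (j + 1) = 0 := by linarith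
  have hy : y b (j + 1) = 0 := by linarith
  simp [level, h1, hx, hy]

theorem level_of_q (h : IsGridMatching g k e p q x y) (b : L) (j : ℕ) (hj : j + 2 < g)
    (hq : q b (j + 2) = 1) : level k p q false b (j + 2) = level k p q true (b + k) (j + 2) := by
  have h1 := (h.qHeight_eq b j (by omega)).1
  have h2 := (h.qHeight_eq (b + k) j (by omega)).2
  have hu := h.u_succ b (j + 1) hj
  have hv := h.v_succ (b + k) (j + 1) hj
  rw [add_sub_cancel_right] at h2 hv
  have := h.x_nonneg b (j + 1)
  have := h.x_nonneg b (j + 2)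
  have := h.y_nonneg (b + k) (j + 1)
  have := h.y_nonneg (b + k) (j + 2)
  have := h.p_nonneg b (j + 2)
  have := h.p_nonneg (b + k) (j + 2)
  have hx : x b (j + 1) = 0 := by linarith
  have hy : y (b + k) (j + 1) = 0 := by linarith
  rw [hx] at h1
  rw [hy] at h2
  simp only [level, Nat.add_one_sub_one, add_sub_cancel_right, if_true, Bool.false_eq_true,
    if_false]
  split_ifs <;> linarith

/-- The level of the left end of an edge that leaves column `j + 2` to the right. -/
theorem level_eq_of_x (h : IsGridMatching g k e p q x y) (b : L) (j : ℕ) (hj : j + 2 < g)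
    (hx : x b (j + 2) = 1) :
    level k p q false b (j + 2) = if Even j then qHeight q b (j + 2) else pHeight p b (j + 2) := by
  have h1 := (h.qHeight_eq b (j + 1) hj).1
  rw [hx] at h1
  by_cases hE : Even j
  · have hE' : ¬ Even (j + 1) := by grind
    have hE2 : Even (j + 2) := by grind
    simp only [level, qHeight, pHeight, hE, hE', hE2, if_true, if_false, Nat.add_one_sub_one] at *
    linarith
  · have hE' : Even (j + 1) := by grind
    have hE2 : ¬ Even (j + 2) := by grind
    simp only [level, qHeight, pHeight, hE, hE', hE2, if_true, if_false, Nat.add_one_sub_one,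
      Bool.false_eq_true] at *
    linarith

theorem level_eq_of_y (h : IsGridMatching g k e p q x y) (b : L) (j : ℕ) (hj : j + 2 < g)
    (hy : y b (j + 2) = 1) :
    level k p q true b (j + 2) =
      if Even j then qHeight q (b - k) (j + 2) else pHeight p b (j + 2) := by
  have h1 := (h.qHeight_eq b (j + 1) hj).2
  rw [hy] at h1
  by_cases hE : Even j
  · have hE' : ¬ Even (j + 1) := by grind
    have hE2 : Even (j + 2) := by grind
    simp only [level, qHeight, pHeight, hE, hE', hE2, if_true, if_false, Nat.add_one_sub_one] at *
    linarith
  · have hE' : Even (j + 1) := by grind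
    have hE2 : ¬ Even (j + 2) := by grind
    simp only [level, qHeight, pHeight, hE, hE', hE2, if_true, if_false, Nat.add_one_sub_one] at *
    linarith

theorem level_of_x (h : IsGridMatching g k e p q x y) (b : L) (j : ℕ) (hj : j + 2 < g)
    (hx : x b (j + 2) = 1) : level k p q false b (j + 2) = level k p q false b (j + 3) := by
  rw [h.level_eq_of_x b j hj hx]
  have : Even (j + 3) ↔ ¬ Even j := by grind
  by_cases hE : Even j <;> simp [level, this, hE]

theorem level_of_y (h : IsGridMatching g k e p q x y) (b : L) (j : ℕ) (hj : j + 2 < g)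
    (hy : y b (j + 2) = 1) : level k p q true b (j + 2) = level k p q true b (j + 3) := by
  rw [h.level_eq_of_y b j hj hy]
  have : Even (j + 3) ↔ ¬ Even j := by grind
  by_cases hE : Even j <;> simp [level, this, hE]

/-- The level of the edges that leave the last column to the right. -/
def lastLevel (g : ℕ) (e : L) (p : L → ℕ → ℤ) (b : L) : ℤ :=
  if Even g then pHeight p b (g - 1) - p (b + e) 0 else pHeight p b (g - 1) - 1 + p (b + e) 0

theorem lastLevel_eq (h : IsGridMatching g k e p q x y) (hg : 5 ≤ g) (b : L) :
    (lastLevel g e p b = if Even g then qHeight q b (g - 1) - 1 + q (b + e) 0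
      else qHeight q b (g - 1) - q (b + e) 0) ∧
    (lastLevel g e p b = if Even g then qHeight q (b - k) (g - 1) - 1 + q (b + e - k) 0
      else qHeight q (b - k) (g - 1) - q (b + e - k) 0) := by
  obtain ⟨m, rfl⟩ : ∃ m, g = m + 2 := ⟨g - 2, by omega⟩
  have h1 := h.qHeight_eq b m (by omega)
  have hu := h.u_zero b
  have hv := h.v_zero b
  have hE : Even (m + 2) ↔ Even m := by grind
  simp only [lastLevel, hE]
  rw [show m + 2 - 1 = m + 1 from rfl] at *
  split_ifs at * <;> constructor <;> linarith

theorem lastLevel_const (h : IsGridMatching g k e p q x y) (hg : 5 ≤ g)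
    (hk : ∀ b, b ∈ AddSubgroup.zmultiples k) (b c : L) :
    lastLevel g e p b = lastLevel g e p c := by
  have step : ∀ b, lastLevel g e p (b - k) = lastLevel g e p b := fun b => by
    rw [(h.lastLevel_eq hg b).2, (h.lastLevel_eq hg (b - k)).1, sub_add_eq_add_sub b k e]
  have key : ∀ z : ℤ, ∀ b, lastLevel g e p (b + z • k) = lastLevel g e p b := by
    intro z
    induction z with
    | zero => simp
    | succ i ih =>
      intro b
      rw [← ih b, ← step, add_smul, one_smul, ← add_assoc, add_sub_cancel_right]
    | pred i ih =>
      intro b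
      rw [sub_smul, one_smul, ← add_sub_assoc, step, ih]
  obtain ⟨z, hz⟩ := AddSubgroup.mem_zmultiples_iff.1 (hk (b - c))
  rw [← key z c, hz, add_sub_cancel]

theorem level_last_of_x (h : IsGridMatching g k e p q x y) (hg : 5 ≤ g) (b : L)
    (hx : x b (g - 1) = 1) : level k p q false b (g - 1) = lastLevel g e p b := by
  obtain ⟨m, rfl⟩ : ∃ m, g = m + 3 := ⟨g - 3, by omega⟩
  have h1 := h.level_eq_of_x b m (by omega) hx
  have h2 := (h.lastLevel_eq hg b).1
  have hu := h.u_zero b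
  have := h.p_nonneg (b + e) 0
  have := h.q_nonneg (b + e) 0
  have hp : p (b + e) 0 = 0 := by linarith
  have hq : q (b + e) 0 = 0 := by linarith
  have hE : Even (m + 3) ↔ ¬ Even m := by grind
  rw [show m + 3 - 1 = m + 2 from rfl] at *
  rw [h1]
  by_cases hm : Even m
  · simp_all
  · simp_all [lastLevel]

theorem level_last_of_y (h : IsGridMatching g k e p q x y) (hg : 5 ≤ g) (b : L)
    (hy : y b (g - 1) = 1) : level k p q true b (g - 1) = lastLevel g e p b := by
  obtain ⟨m, rfl⟩ : ∃ m, g = m + 3 := ⟨g - 3, by omega⟩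
  have h1 := h.level_eq_of_y b m (by omega) hy
  have h2 := (h.lastLevel_eq hg b).2
  have hv := h.v_zero b
  have := h.p_nonneg (b + e) 0
  have := h.q_nonneg (b + e - k) 0
  have hp : p (b + e) 0 = 0 := by linarith
  have hq : q (b + e - k) 0 = 0 := by linarith
  have hE : Even (m + 3) ↔ ¬ Even m := by grind
  rw [show m + 3 - 1 = m + 2 from rfl] at *
  rw [h1]
  by_cases hm : Even m
  · simp_all
  · simp_all [lastLevel]

theorem level_two (t : Bool) (b : L) : level k p q t b 2 = p b 1 := by
  simp [level, pHeight]

theorem p_one_eq_zero_of_x (h : IsGridMatching g k e p q x y) (hg : 5 ≤ g) (b : L)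
    (hx : x b 1 = 1) : p b 1 = 0 ∧ q b 1 = 0 := by
  have := h.u_succ b 0 (by omega)
  have := h.x_zero b
  have := h.p_nonneg b 1
  have := h.q_nonneg b 1
  simp only [zero_add] at *
  constructor <;> linarith

theorem p_one_eq_zero_of_y (h : IsGridMatching g k e p q x y) (hg : 5 ≤ g) (b : L)
    (hy : y b 1 = 1) : p b 1 = 0 ∧ q (b - k) 1 = 0 := by
  have := h.v_succ b 0 (by omega)
  have := h.y_zero b
  have := h.p_nonneg b 1
  have := h.q_nonneg (b - k) 1
  simp only [zero_add] at *
  constructor <;> linarith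

/-- A level set in the columns `j ≥ 2`, together with a part of the columns `0` and `1`, is
invariant if the conditions on the edges at these two columns hold. -/
theorem isEdgeInvariant_level (h : IsGridMatching g k e p q x y) (hg : 5 ≤ g) (c : ℤ)
    (Z : Bool → L → Prop)
    (hp : ∀ b j, j ≤ 1 → p b j = 1 → (Z false b ↔ Z true b))
    (hq : ∀ b j, j ≤ 1 → q b j = 1 → (Z false b ↔ Z true (b + k)))
    (hx : ∀ b, x b 1 = 1 → (Z false b ↔ 0 = c))
    (hy : ∀ b, y b 1 = 1 → (Z true b ↔ 0 = c))
    (hx' : ∀ b, x b (g - 1) = 1 → (lastLevel g e p b = c ↔ Z false (b + e)))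
    (hy' : ∀ b, y b (g - 1) = 1 → (lastLevel g e p b = c ↔ Z true (b + e))) :
    IsEdgeInvariant g k e p q x y
      fun t b j => if j ≤ 1 then Z t b else level k p q t b j = c where
  rung := by simp
  even b j h2 hj hE := by
    simp [level, hE, show ¬ j ≤ 1 by omega]
  odd b j h2 hj hE := by
    simp [level, hE, show ¬ j ≤ 1 by omega]
  of_p b j hj hp1 := by
    by_cases h1 : j ≤ 1
    · simp [h1, hp b j h1 hp1]
    · obtain ⟨i, rfl⟩ : ∃ i, j = i + 2 := ⟨j - 2, by omega⟩
      simp [h.level_of_p b i hj hp1]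
  of_q b j hj hq1 := by
    by_cases h1 : j ≤ 1
    · simp [h1, hq b j h1 hq1]
    · obtain ⟨i, rfl⟩ : ∃ i, j = i + 2 := ⟨j - 2, by omega⟩
      simp [h.level_of_q b i hj hq1]
  of_x b j hj hx1 := by
    match j, hj, hx1 with
    | 0, _, hx1 => simp
    | 1, _, hx1 => simp [hx b hx1, level_two, (h.p_one_eq_zero_of_x hg b hx1).1]
    | i + 2, hj, hx1 => simp [h.level_of_x b i (by omega) hx1]
  of_y b j hj hy1 := by
    match j, hj, hy1 with
    | 0, _, hy1 => simp
    | 1, _, hy1 => simp [hy b hy1, level_two, (h.p_one_eq_zero_of_y hg b hy1).1]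
    | i + 2, hj, hy1 => simp [h.level_of_y b i (by omega) hy1]
  of_x_last b hx1 := by
    simp [show ¬ g ≤ 1 + 1 by omega, h.level_last_of_x hg b hx1, hx' b hx1]
  of_y_last b hy1 := by
    simp [show ¬ g ≤ 1 + 1 by omega, h.level_last_of_y hg b hy1, hy' b hy1]

theorem exists_level_eq_one (h : IsGridMatching g k e p q x y) (hg : 5 ≤ g) (b : L) :
    ∃ j, 2 ≤ j ∧ j < g ∧ level k p q false b j = 1 := by
  have hp1 := h.p_nonneg b 1
  have hp3 := h.p_nonneg b 3
  have hu1 := h.u_succ b 0 (by omega)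
  have hu3 := h.u_succ b 2 (by omega)
  have := h.x_nonneg b 1
  have := h.x_nonneg b 2
  have := h.x_nonneg b 3
  have := h.q_nonneg b 1
  have := h.q_nonneg b 3
  have := h.x_zero b
  have h2 := (h.qHeight_eq b 1 (by omega)).1
  simp [pHeight] at *
  obtain h0 | h0 : p b 1 = 0 ∨ p b 1 = 1 := by omega
  · obtain h0' | h0' : p b 3 = 0 ∨ p b 3 = 1 := by omega
    · exact ⟨4, by omega, by omega, by simp [level, pHeight, h0, h0', show Even 4 by decide]⟩
    · refine ⟨3, by omega, by omega, ?_⟩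
      simp [level, show ¬ Even 3 by decide]
      omega
  · exact ⟨2, by omega, by omega, by simp [level_two, h0]⟩

/-- The four-cycle formed by two `q`-edges in the columns `0` and `1`. -/
theorem isEdgeInvariant_square (h : IsGridMatching g k e p q x y) (hg : 5 ≤ g) (b : L)
    (h0 : q b 0 = 1) (h1 : q b 1 = 1) :
    IsEdgeInvariant g k e p q x y
      fun t c j => j ≤ 1 ∧ c = if t then b + k else b := by
  have hu0 := h.u_zero (b - e)
  have hv0 := h.v_zero (b + k - e)
  have hu1 := h.u_succ b 0 (by omega)
  have hv1 := h.v_succ (b + k) 0 (by omega)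
  simp only [sub_add_cancel, zero_add, add_sub_cancel_right, h.x_zero, h.y_zero] at hu0 hv0 hu1 hv1
  have hp0 := h.p_nonneg b 0
  have hp0' := h.p_nonneg (b + k) 0
  have hp1 := h.p_nonneg b 1
  have hp1' := h.p_nonneg (b + k) 1
  have hxl := h.x_nonneg (b - e) (g - 1)
  have hyl := h.y_nonneg (b + k - e) (g - 1)
  have hx1 := h.x_nonneg b 1
  have hy1 := h.y_nonneg (b + k) 1
  refine ⟨by simp, fun c j _ _ _ => by simp; omega, fun c j _ _ _ => by simp,
    fun c j _ hp => ?_, fun c j _ _ => by simp, fun c j _ hx => ?_, fun c j _ hy => ?_,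
    fun c hx => ?_, fun c hy => ?_⟩
  · by_cases hj : j ≤ 1
    · have : c ≠ b ∧ c ≠ b + k := by
        constructor <;> rintro rfl <;> interval_cases j <;> omega
      simp [this]
    · simp [hj]
  · match j, hx with
    | 0, _ => simp
    | 1, hx =>
      have : c ≠ b := by rintro rfl; omega
      simp [this]
    | i + 2, _ => simp
  · match j, hy with
    | 0, _ => simp
    | 1, hy =>
      have : c ≠ b + k := by rintro rfl; omega
      simp [this]
    | i + 2, _ => simp
  · have : c + e ≠ b := by
      rintro rfl
      rw [add_sub_cancel_right] at *
      omega
    simp [this]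
    omega
  · have : c + e ≠ b + k := by
      intro hc
      rw [← hc, add_sub_cancel_right] at hv0 hyl
      have := hc ▸ hp0'
      omega
    simp [this]
    omega

theorem two_add_le_pHeight (h : IsGridMatching g k e p q x y) (hg : 5 ≤ g) (b : L) :
    2 + p b 1 ≤ pHeight p b (g - 1) := by
  obtain ⟨m, rfl⟩ : ∃ m, g = m + 5 := ⟨g - 5, by omega⟩
  have := h.pHeight_mono b (show 3 ≤ m + 3 by omega)
  have := h.p_nonneg b 3
  simp [pHeight, show Even 2 by decide] at *
  omega

theorem two_sub_le_qHeight (h : IsGridMatching g k e p q x y) (hg : 5 ≤ g) (b : L) :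
    2 - q b 1 ≤ qHeight q b (g - 1) := by
  obtain ⟨m, rfl⟩ : ∃ m, g = m + 5 := ⟨g - 5, by omega⟩
  have := h.qHeight_mono b (show 2 ≤ m + 3 by omega)
  have := h.q_nonneg b 2
  simp [qHeight] at *
  omega

theorem three_sub_le_qHeight (h : IsGridMatching g k e p q x y) (hg : 6 ≤ g) (b : L) :
    3 - q b 1 ≤ qHeight q b (g - 1) := by
  obtain ⟨m, rfl⟩ : ∃ m, g = m + 6 := ⟨g - 6, by omega⟩
  have := h.qHeight_mono b (show 4 ≤ m + 4 by omega)
  have := h.q_nonneg b 2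
  have := h.q_nonneg b 4
  simp [qHeight, show Even 2 by decide, show ¬ Even 3 by decide] at *
  omega

theorem q_one_mem (h : IsGridMatching g k e p q x y) (hg : 5 ≤ g) (b : L) :
    q b 1 = 0 ∨ q b 1 = 1 := by
  have := h.u_succ b 0 (by omega)
  have := h.x_zero b
  have := h.p_nonneg b 1
  have := h.q_nonneg b 1
  have := h.x_nonneg b 1
  simp only [zero_add] at *
  omega

theorem q_zero_mem (h : IsGridMatching g k e p q x y) (b : L) :
    q b 0 = 0 ∨ q b 0 = 1 := by
  have := h.u_zero (b - e)
  rw [sub_add_cancel] at this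
  have := h.p_nonneg b 0
  have := h.q_nonneg b 0
  have := h.x_nonneg (b - e) (g - 1)
  omega

theorem exists_isEdgeInvariant [Finite L] (h : IsGridMatching g k e p q x y) (hg : 5 ≤ g)
    (hk : ∀ b, b ∈ AddSubgroup.zmultiples k) :
    ∃ P, IsEdgeInvariant g k e p q x y P ∧ (∃ t b j, j < g ∧ P t b j) ∧
      ∃ t b j, j < g ∧ ¬ P t b j := by
  obtain ⟨i₁, h2, hlt, hlev⟩ := h.exists_level_eq_one hg 0
  by_cases hl : lastLevel g e p 0 = 1
  · replace hl : ∀ b, lastLevel g e p b = 1 := fun b => by rw [← hl, h.lastLevel_const hg hk]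
    by_cases hsq : ∃ b, q b 0 = 1 ∧ q b 1 = 1
    · obtain ⟨b, hb0, hb1⟩ := hsq
      refine ⟨_, h.isEdgeInvariant_square hg b hb0 hb1, ⟨false, b, 0, by omega, by simp⟩,
        false, b, 2, by omega, by simp⟩
    · push Not at hsq
      have hp1 : ∀ b, p b 1 = 0 := fun b => by
        have h1 := hl b
        have := h.two_add_le_pHeight hg b
        have := h.p_nonneg b 1
        have := h.p_nonneg (b + e) 0
        have := h.u_zero b
        have := h.q_nonneg (b + e) 0
        have := h.x_nonneg b (g - 1)
        unfold lastLevel at h1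
        split_ifs at h1 <;> omega
      have hpq : ∀ b, q b 1 = 0 → q b 0 = 1 ∧ ¬ Even g := by
        have hlast : ∀ b, q b 1 = 0 → q (b + e) 0 = 1 ∧ ¬ Even g := fun b hb => by
          have h1 := (h.lastLevel_eq hg b).1
          rw [hl b] at h1
          have := h.two_sub_le_qHeight hg b
          have h3 := h.q_zero_mem (b + e)
          split_ifs at h1 with hE
          · have hg6 : 6 ≤ g := by grind
            have := h.three_sub_le_qHeight hg6 b
            omega
          · exact ⟨by omega, hE⟩
        have hstep : ∀ b, q b 1 = 0 → q (b + e) 1 = 0 := fun b hb =>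
          (h.q_one_mem hg _).resolve_right (hsq _ (hlast b hb).1)
        have hmul : ∀ (m : ℕ) b, q b 1 = 0 → q (b + m • e) 1 = 0 := by
          intro m
          induction m with
          | zero => simp
          | succ m ih =>
            intro b hb
            rw [add_smul, one_smul, ← add_assoc]
            exact hstep _ (ih b hb)
        intro b hb
        have h1 := hmul (addOrderOf e - 1) b hb
        have h2 := hlast _ h1
        rwa [add_assoc, ← succ_nsmul, Nat.sub_add_cancel (addOrderOf_pos e),
          addOrderOf_nsmul_eq_zero,
          add_zero] at h2
      have hp0 : ∀ b, ¬ Even g → p b 0 = 0 := fun b hE => by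
        have h1 := hl (b - e)
        have := h.two_add_le_pHeight hg (b - e)
        have := hp1 (b - e)
        have := h.p_nonneg b 0
        simp only [lastLevel, hE, if_false, sub_add_cancel] at h1
        omega
      refine ⟨_, h.isEdgeInvariant_level hg 0 (fun t b => q (if t then b - k else b) 1 = 0)
        ?_ ?_ ?_ ?_ ?_ ?_, ⟨false, 0, 2, by omega, by simp [level_two, hp1]⟩,
        false, 0, i₁, hlt, ?_⟩
      · intro b j hj hp
        by_cases hE : Even g
        · have hf : ∀ c, ¬ q c 1 = 0 := fun c hc => (hpq c hc).2 hE
          simp [hf]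
        · have := hp0 b hE
          have := hp1 b
          interval_cases j <;> omega
      · intro b j hj _
        simp
      · intro b hx
        simp [(h.p_one_eq_zero_of_x hg b hx).2]
      · intro b hy
        simp [(h.p_one_eq_zero_of_y hg b hy).2]
      · intro b hx
        have := h.u_zero b
        have := h.p_nonneg (b + e) 0
        have hq : ¬ q (b + e) 1 = 0 := fun hq => by
          have := hpq _ hq
          omega
        simp [hl, hq]
      · intro b hy
        have := h.v_zero b
        have := h.p_nonneg (b + e) 0
        have hq : ¬ q (b + e - k) 1 = 0 := fun hq => by
          have := hpq _ hq
          omega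
        simp [hl, hq]
      · simp [hlev, show ¬ i₁ ≤ 1 by omega]
  · replace hl : ∀ b, lastLevel g e p b ≠ 1 := fun b => by rwa [h.lastLevel_const hg hk b 0]
    refine ⟨_, h.isEdgeInvariant_level hg 1 (fun _ _ => False) (by simp) (by simp) (by simp)
      (by simp) (by simp [hl]) (by simp [hl]), ⟨false, 0, i₁, hlt, ?_⟩,
      false, 0, 0, by omega, by simp⟩
    simp [hlev, show ¬ i₁ ≤ 1 by omega]

end IsGridMatching

/-- A nonempty vertex set that is closed under two matchings whose union is a Hamiltonian cycle
contains all vertices. -/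
theorem SimpleGraph.Walk.IsHamiltonianCycle.mem_of_closed {V : Type*} [DecidableEq V]
    {G : SimpleGraph V} {M N : G.Subgraph} {v : V} {c : G.Walk v v} (hc : c.IsHamiltonianCycle)
    (hMN : {e | e ∈ c.edges} = M.edgeSet ∪ N.edgeSet) {S : Set V}
    (hM : ∀ a b, M.Adj a b → a ∈ S → b ∈ S) (hN : ∀ a b, N.Adj a b → a ∈ S → b ∈ S)
    {s : V} (hs : s ∈ S) (w : V) : w ∈ S := by
  have key : ∀ {a b : V} (r : G.Walk a b), (∀ e ∈ r.edges, e ∈ c.edges) → a ∈ S →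
      ∀ z ∈ r.support, z ∈ S := by
    intro a b r
    induction r with
    | nil => simp
    | cons hab r ih =>
      intro hr ha z hz
      simp only [Walk.edges_cons, List.mem_cons, forall_eq_or_imp] at hr
      rw [Walk.support_cons, List.mem_cons] at hz
      obtain rfl | hz := hz
      · exact ha
      · refine ih hr.2 ?_ z hz
        obtain h | h := hMN.subset hr.1
        · exact hM _ _ h ha
        · exact hN _ _ h ha
  have hsc := hc.mem_support s
  refine key (c.rotate s hsc) (fun e he => ?_) hs w ?_
  · exact (c.rotate_edges s hsc).mem_iff.1 he
  · exact (c.mem_support_rotate_iff s hsc).2 (hc.mem_support w)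

section Accordion

variable {n k : ℕ}

/-- The column of an index: its residue modulo `gcd n k`. -/
def column (n k : ℕ) (i : ZMod n) : ℕ :=
  (ZMod.castHom (Nat.gcd_dvd_left n k) (ZMod (n.gcd k)) i).val

theorem gcd_mem_zmultiples (n k : ℕ) :
    ((n.gcd k : ℕ) : ZMod n) ∈ AddSubgroup.zmultiples (k : ZMod n) := by
  refine AddSubgroup.mem_zmultiples_iff.2 ⟨n.gcdB k, ?_⟩
  have := congrArg (Int.cast : ℤ → ZMod n) (Nat.gcd_eq_gcd_ab n k)
  push_cast at this
  rw [this]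
  simp [mul_comm]

theorem column_add (b : AddSubgroup.zmultiples (k : ZMod n)) {j : ℕ} (hj : j < n.gcd k) :
    column n k (b + j) = j := by
  obtain ⟨b, hb⟩ := b
  obtain ⟨z, rfl⟩ := AddSubgroup.mem_zmultiples_iff.1 hb
  have hk : ((k : ℕ) : ZMod (n.gcd k)) = 0 :=
    (ZMod.natCast_eq_zero_iff _ _).2 (Nat.gcd_dvd_right n k)
  simp only [column, map_add, map_zsmul, map_natCast, hk, smul_zero, zero_add]
  exact ZMod.val_cast_of_lt hj

theorem coord_unique {b c : AddSubgroup.zmultiples (k : ZMod n)} {i j : ℕ} (hi : i < n.gcd k)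
    (hj : j < n.gcd k) (h : (b + i : ZMod n) = c + j) : b = c ∧ i = j := by
  have hij : i = j := by rw [← column_add b hi, h, column_add c hj]
  subst hij
  exact ⟨Subtype.ext (add_right_cancel h), rfl⟩

theorem exists_coord [NeZero n] (i : ZMod n) :
    ∃ (b : AddSubgroup.zmultiples (k : ZMod n)) (j : ℕ), j < n.gcd k ∧ i = b + j := by
  refine ⟨⟨((i.val / n.gcd k) • (n.gcd k : ZMod n)), AddSubgroup.nsmul_mem _
    (gcd_mem_zmultiples n k) _⟩, i.val % n.gcd k,
    Nat.mod_lt _ (Nat.gcd_pos_of_pos_left _ (NeZero.pos n)), ?_⟩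
  have := congrArg (Nat.cast : ℕ → ZMod n) (Nat.div_add_mod i.val (n.gcd k))
  rw [ZMod.natCast_zmod_val] at this
  refine this.symm.trans ?_
  push_cast
  rw [nsmul_eq_mul, mul_comm]

/-- The partner of a vertex in a perfect matching of the accordion graph that consists of all edges
between the columns `0` and `1`, of the edges `u_i v_i` in the other even columns, and of the edges
`u_i v_{i+k}` in the other odd columns. -/
def partner (n k : ℕ) (v : Bool × ZMod n) : Bool × ZMod n :=
  if column n k v.2 = 0 then (v.1, v.2 + 1)
  else if column n k v.2 = 1 then (v.1, v.2 - 1)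
  else if Even (column n k v.2) then (!v.1, v.2)
  else (!v.1, if v.1 then v.2 - k else v.2 + k)

theorem partner_zero (hg : 5 ≤ n.gcd k) (t : Bool) (b : AddSubgroup.zmultiples (k : ZMod n)) :
    partner n k (t, (b : ZMod n)) = (t, (b : ZMod n) + 1) := by
  have := column_add b (show 0 < n.gcd k by omega)
  rw [Nat.cast_zero, add_zero] at this
  simp [partner, this]

theorem partner_one (hg : 5 ≤ n.gcd k) (t : Bool) (b : AddSubgroup.zmultiples (k : ZMod n)) :
    partner n k (t, (b : ZMod n) + 1) = (t, (b : ZMod n)) := by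
  have := column_add b (show 1 < n.gcd k by omega)
  rw [Nat.cast_one] at this
  simp [partner, this]

theorem partner_even (t : Bool) (b : AddSubgroup.zmultiples (k : ZMod n)) {j : ℕ} (h2 : 2 ≤ j)
    (hj : j < n.gcd k) (hE : Even j) :
    partner n k (t, (b + j : ZMod n)) = (!t, (b + j : ZMod n)) := by
  simp [partner, column_add b hj, hE, show j ≠ 0 by omega, show j ≠ 1 by omega]

theorem partner_odd (t : Bool) (b : AddSubgroup.zmultiples (k : ZMod n)) {j : ℕ} (h2 : 2 ≤ j)
    (hj : j < n.gcd k) (hE : ¬ Even j) : partner n k (t, (b + j : ZMod n)) =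
      (!t, if t then (b + j - k : ZMod n) else (b + j + k : ZMod n)) := by
  simp [partner, column_add b hj, hE, show j ≠ 0 by omega, show j ≠ 1 by omega]

/-- The subgroup generated by `k`, with its generator. -/
abbrev gen (n k : ℕ) : AddSubgroup.zmultiples (k : ZMod n) :=
  ⟨k, AddSubgroup.mem_zmultiples _⟩

theorem partner_partner [NeZero n] (hg : 5 ≤ n.gcd k) (v : Bool × ZMod n) :
    partner n k (partner n k v) = v := by
  obtain ⟨t, i⟩ := v
  obtain ⟨b, j, hj, rfl⟩ := exists_coord (k := k) i
  obtain rfl | rfl | h2 : j = 0 ∨ j = 1 ∨ 2 ≤ j := by omega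
  · simp [partner_zero hg, partner_one hg]
  · simp [partner_zero hg, partner_one hg]
  · by_cases hE : Even j
    · simp [partner_even _ b h2 hj hE]
    · rw [partner_odd t b h2 hj hE]
      cases t
      · have := partner_odd true (b + gen n k) h2 hj hE
        simp only [AddSubgroup.coe_add] at this
        simp [add_right_comm _ (j : ZMod n), this]
        ring
      · have := partner_odd false (b - gen n k) h2 hj hE
        simp only [AddSubgroup.coe_sub] at this
        simp [add_sub_right_comm _ (j : ZMod n), this]
        ring

theorem accordion_adj {v w : Bool × ZMod n} : (accordion n k).Adj v w ↔ v ≠ w ∧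
    (((v.1 = w.1 ∧ w.2 = v.2 + 1) ∨
      (v.1 = false ∧ w.1 = true ∧ (w.2 = v.2 ∨ w.2 = v.2 + k))) ∨
    ((w.1 = v.1 ∧ v.2 = w.2 + 1) ∨
      (w.1 = false ∧ v.1 = true ∧ (v.2 = w.2 ∨ v.2 = w.2 + k)))) :=
  SimpleGraph.fromRel_adj _ _ _

theorem adj_partner [NeZero n] (hn : 3 ≤ n) (hg : 5 ≤ n.gcd k) (v : Bool × ZMod n) :
    (accordion n k).Adj v (partner n k v) := by
  have : Fact (1 < n) := ⟨by omega⟩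
  obtain ⟨t, i⟩ := v
  obtain ⟨b, j, hj, rfl⟩ := exists_coord (k := k) i
  obtain rfl | rfl | h2 : j = 0 ∨ j = 1 ∨ 2 ≤ j := by omega
  · simp [partner_zero hg, accordion_adj]
  · simp [partner_one hg, accordion_adj]
  · by_cases hE : Even j
    · rw [partner_even _ b h2 hj hE]
      cases t <;> simp [accordion_adj]
    · rw [partner_odd _ b h2 hj hE]
      cases t <;> simp [accordion_adj]

theorem exists_isPerfectMatching_partner [NeZero n] (hn : 3 ≤ n) (hg : 5 ≤ n.gcd k) :
    ∃ M : (accordion n k).Subgraph, M.IsPerfectMatching ∧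
      ∀ v w, M.Adj v w ↔ partner n k v = w := by
  refine ⟨{ verts := Set.univ
            Adj := fun v w => partner n k v = w
            adj_sub := ?_
            edge_vert := fun _ => Set.mem_univ _
            symm := ?_ },
    ⟨fun v _ => ⟨partner n k v, rfl, fun w hw => Eq.symm hw⟩, fun v => Set.mem_univ v⟩,
    fun v w => Iff.rfl⟩
  · rintro v _ rfl
    exact adj_partner hn hg v
  · constructor
    rintro v _ rfl
    exact partner_partner hg v

open Classical in
/-- The indicator of an edge of a subgraph. -/
noncomputable def edgeIndicator {V : Type*} {G : SimpleGraph V} (N : G.Subgraph) (v w : V) : ℤ :=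
  if N.Adj v w then 1 else 0

theorem edgeIndicator_nonneg {V : Type*} {G : SimpleGraph V} (N : G.Subgraph) (v w : V) :
    0 ≤ edgeIndicator N v w := by
  unfold edgeIndicator
  split_ifs <;> simp

theorem edgeIndicator_eq_one {V : Type*} {G : SimpleGraph V} {N : G.Subgraph} {v w : V} :
    edgeIndicator N v w = 1 ↔ N.Adj v w := by
  simp [edgeIndicator]

theorem edgeIndicator_eq_zero {V : Type*} {G : SimpleGraph V} {N : G.Subgraph} {v w : V} :
    edgeIndicator N v w = 0 ↔ ¬ N.Adj v w := by
  simp [edgeIndicator]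

theorem natCast_ne_zero_of_lt {a : ℕ} (h0 : 0 < a) (h : a < n) : (a : ZMod n) ≠ 0 := fun h' =>
  absurd (Nat.le_of_dvd h0 ((ZMod.natCast_eq_zero_iff a n).1 h')) (by omega)

theorem edgeIndicator_sum_false (hn : 3 ≤ n) (hk : 0 < k) (hkn : k < n)
    {N : (accordion n k).Subgraph} (hN : N.IsPerfectMatching) (i : ZMod n) :
    edgeIndicator N (false, i) (true, i) + edgeIndicator N (false, i) (true, i + k) +
      edgeIndicator N (false, i) (false, i + 1) + edgeIndicator N (false, i - 1) (false, i) = 1 := by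
  have hk0 : (k : ZMod n) ≠ 0 := natCast_ne_zero_of_lt hk hkn
  have h2 : i + 1 ≠ i - 1 := fun h => natCast_ne_zero_of_lt (n := n) two_pos (by omega) (by
    push_cast
    linear_combination h)
  obtain ⟨w, hw, huniq⟩ := hN.1 (hN.2 (false, i))
  have hiff : ∀ z, N.Adj (false, i) z ↔ z = w := fun z => ⟨huniq z, fun h => h ▸ hw⟩
  simp only [edgeIndicator, N.adj_comm (false, i - 1), hiff]
  obtain ⟨t, a⟩ := w
  have hadj := accordion_adj.1 (N.adj_sub hw)
  cases t
  · obtain rfl | rfl : a = i + 1 ∨ a = i - 1 := by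
      rcases hadj.2 with (h | h) | (h | h)
      · exact Or.inl h.2
      · simp at h
      · exact Or.inr (eq_sub_of_add_eq h.2.symm)
      · simp at h
    · simp [h2.symm]
    · simp [h2]
  · obtain rfl | rfl : a = i ∨ a = i + k := by
      rcases hadj.2 with (h | h) | (h | h)
      · simp at h
      · exact h.2.2
      · simp at h
      · simp at h
    · simp [hk0]
    · simp [hk0]

theorem edgeIndicator_sum_true (hn : 3 ≤ n) (hk : 0 < k) (hkn : k < n)
    {N : (accordion n k).Subgraph} (hN : N.IsPerfectMatching) (i : ZMod n) :
    edgeIndicator N (false, i) (true, i) + edgeIndicator N (false, i - k) (true, i) +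
      edgeIndicator N (true, i) (true, i + 1) + edgeIndicator N (true, i - 1) (true, i) = 1 := by
  have hk0 : (k : ZMod n) ≠ 0 := natCast_ne_zero_of_lt hk hkn
  have h2 : i + 1 ≠ i - 1 := fun h => natCast_ne_zero_of_lt (n := n) two_pos (by omega) (by
    push_cast
    linear_combination h)
  obtain ⟨w, hw, huniq⟩ := hN.1 (hN.2 (true, i))
  have hiff : ∀ z, N.Adj (true, i) z ↔ z = w := fun z => ⟨huniq z, fun h => h ▸ hw⟩
  simp only [edgeIndicator, N.adj_comm _ (true, i), hiff]
  obtain ⟨t, a⟩ := w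
  have hadj := accordion_adj.1 (N.adj_sub hw)
  cases t
  · obtain rfl | rfl : a = i ∨ a = i - k := by
      rcases hadj.2 with (h | h) | (h | h)
      · simp at h
      · simp at h
      · simp at h
      · exact h.2.2.imp Eq.symm fun h => eq_sub_of_add_eq h.symm
    · simp [hk0]
    · have hk1 : i ≠ i - k := fun h => hk0 (by linear_combination h)
      simp [hk1]
  · obtain rfl | rfl : a = i + 1 ∨ a = i - 1 := by
      rcases hadj.2 with (h | h) | (h | h)
      · exact Or.inl h.2
      · simp at h
      · exact Or.inr (eq_sub_of_add_eq h.2.symm)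
      · simp at h
    · simp [h2.symm]
    · simp [h2]

/-- The element `gcd n k` of the subgroup generated by `k`. -/
abbrev gcdElem (n k : ℕ) : AddSubgroup.zmultiples (k : ZMod n) :=
  ⟨(n.gcd k : ℕ), gcd_mem_zmultiples n k⟩

theorem isGridMatching_edgeIndicator (hn : 3 ≤ n) (hk : 0 < k) (hkn : k < n)
    (hg : 5 ≤ n.gcd k) {N : (accordion n k).Subgraph} (hN : N.IsPerfectMatching)
    (hpartner : ∀ v, ¬ N.Adj v (partner n k v)) :
    IsGridMatching (n.gcd k) (gen n k) (gcdElem n k)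
      (fun b j => edgeIndicator N (false, (b + j : ZMod n)) (true, (b + j : ZMod n)))
      (fun b j => edgeIndicator N (false, (b + j : ZMod n)) (true, (b + j + k : ZMod n)))
      (fun b j => edgeIndicator N (false, (b + j : ZMod n)) (false, (b + j + 1 : ZMod n)))
      (fun b j => edgeIndicator N (true, (b + j : ZMod n)) (true, (b + j + 1 : ZMod n))) := by
  have hU := edgeIndicator_sum_false hn hk hkn hN
  have hV := edgeIndicator_sum_true hn hk hkn hN
  have hx0 : ∀ b : AddSubgroup.zmultiples (k : ZMod n), ∀ t,
      edgeIndicator N (t, (b : ZMod n)) (t, (b + 1 : ZMod n)) = 0 := fun b t => by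
    have := hpartner (t, (b : ZMod n))
    rw [partner_zero hg] at this
    exact edgeIndicator_eq_zero.2 this
  have hlast : ∀ b : ZMod n, b + ((n.gcd k - 1 : ℕ) : ZMod n) = b + (n.gcd k : ℕ) - 1 := fun b => by
    rw [Nat.cast_sub (by omega), Nat.cast_one]
    ring
  constructor
  · intros; exact edgeIndicator_nonneg _ _ _
  · intros; exact edgeIndicator_nonneg _ _ _
  · intros; exact edgeIndicator_nonneg _ _ _
  · intros; exact edgeIndicator_nonneg _ _ _
  · intro b j hj
    have := hU (b + j + 1)
    rw [add_sub_cancel_right] at this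
    push_cast
    simp only [← add_assoc]
    exact this
  · intro b j hj
    have := hV (b + j + 1)
    rw [add_sub_cancel_right] at this
    have h1 : (b : ZMod n) - k + (j + 1) = b + j + 1 - k := by ring
    push_cast
    simp only [h1, ← add_assoc, sub_add_cancel]
    exact this
  · intro b
    have h0 := hx0 (b + gcdElem n k) false
    have := hU (b + (n.gcd k : ℕ))
    simp only [AddSubgroup.coe_add, Nat.cast_zero, add_zero, hlast, sub_add_cancel] at *
    linarith
  · intro b
    have h0 := hx0 (b + gcdElem n k) true
    have := hV (b + (n.gcd k : ℕ))
    simp only [AddSubgroup.coe_add, AddSubgroup.coe_sub, Nat.cast_zero, add_zero, hlast,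
      sub_add_cancel] at *
    linarith
  · intro b
    simpa using hx0 b false
  · intro b
    simpa using hx0 b true
  · intro b j h2 hj hE
    have := hpartner (false, (b + j : ZMod n))
    rw [partner_even _ b h2 hj hE] at this
    exact edgeIndicator_eq_zero.2 this
  · intro b j h2 hj hE
    have := hpartner (false, (b + j : ZMod n))
    rw [partner_odd _ b h2 hj hE] at this
    exact edgeIndicator_eq_zero.2 this

/-- The vertices of the accordion graph whose coordinates satisfy `P`. -/
def coordSet (n k : ℕ) (P : Bool → AddSubgroup.zmultiples (k : ZMod n) → ℕ → Prop) :
    Set (Bool × ZMod n) :=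
  {v | ∃ (b : AddSubgroup.zmultiples (k : ZMod n)) (j : ℕ), j < n.gcd k ∧ v.2 = b + j ∧ P v.1 b j}

theorem mem_coordSet {P : Bool → AddSubgroup.zmultiples (k : ZMod n) → ℕ → Prop} {t : Bool}
    {b : AddSubgroup.zmultiples (k : ZMod n)} {j : ℕ} (hj : j < n.gcd k) :
    (t, (b + j : ZMod n)) ∈ coordSet n k P ↔ P t b j := by
  refine ⟨?_, fun h => ⟨b, j, hj, rfl, h⟩⟩
  rintro ⟨c, i, hi, h, hP⟩
  obtain ⟨rfl, rfl⟩ := coord_unique hj hi h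
  exact hP

/-- The predicate `P` on coordinates is invariant under the edges of `N` and of the matching given
by `partner`. -/
abbrev IsCoordInvariant (N : (accordion n k).Subgraph)
    (P : Bool → AddSubgroup.zmultiples (k : ZMod n) → ℕ → Prop) : Prop :=
  IsEdgeInvariant (n.gcd k) (gen n k) (gcdElem n k)
    (fun b j => edgeIndicator N (false, (b + j : ZMod n)) (true, (b + j : ZMod n)))
    (fun b j => edgeIndicator N (false, (b + j : ZMod n)) (true, (b + j + k : ZMod n)))
    (fun b j => edgeIndicator N (false, (b + j : ZMod n)) (false, (b + j + 1 : ZMod n)))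
    (fun b j => edgeIndicator N (true, (b + j : ZMod n)) (true, (b + j + 1 : ZMod n))) P

theorem mem_coordSet_iff_of_adj [NeZero n] {N : (accordion n k).Subgraph}
    {P : Bool → AddSubgroup.zmultiples (k : ZMod n) → ℕ → Prop} (hP : IsCoordInvariant N P)
    (hg : 5 ≤ n.gcd k) {v w : Bool × ZMod n}
    (h : N.Adj v w) : v ∈ coordSet n k P ↔ w ∈ coordSet n k P := by
  have key : ∀ v w : Bool × ZMod n, N.Adj v w → ((v.1 = w.1 ∧ w.2 = v.2 + 1) ∨
      (v.1 = false ∧ w.1 = true ∧ (w.2 = v.2 ∨ w.2 = v.2 + k))) →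
      (v ∈ coordSet n k P ↔ w ∈ coordSet n k P) := by
    rintro ⟨t, i⟩ ⟨t', i'⟩ h hr
    obtain ⟨b, j, hj, rfl⟩ := exists_coord (k := k) i
    simp only at hr
    rcases hr with ⟨rfl, rfl⟩ | ⟨rfl, rfl, rfl | rfl⟩
    · rw [mem_coordSet hj]
      by_cases hj1 : j + 1 < n.gcd k
      · rw [add_assoc, ← Nat.cast_add_one, mem_coordSet hj1]
        cases t
        · exact hP.of_x b j hj1 (edgeIndicator_eq_one.2 h)
        · exact hP.of_y b j hj1 (edgeIndicator_eq_one.2 h)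
      · obtain rfl : j = n.gcd k - 1 := by omega
        have h0 : (b : ZMod n) + (n.gcd k - 1 : ℕ) + 1 =
            (b + gcdElem n k : AddSubgroup.zmultiples (k : ZMod n)) + (0 : ℕ) := by
          rw [Nat.cast_sub (by omega), AddSubgroup.coe_add]
          push_cast
          ring
        rw [h0, mem_coordSet (by omega)]
        cases t
        · exact hP.of_x_last b (edgeIndicator_eq_one.2 h)
        · exact hP.of_y_last b (edgeIndicator_eq_one.2 h)
    · rw [mem_coordSet hj, mem_coordSet hj]
      exact hP.of_p b j hj (edgeIndicator_eq_one.2 h)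
    · have h0 : (b : ZMod n) + j + k = (b + gen n k : AddSubgroup.zmultiples (k : ZMod n)) + j := by
        rw [AddSubgroup.coe_add]
        ring
      rw [h0, mem_coordSet hj, mem_coordSet hj]
      exact hP.of_q b j hj (edgeIndicator_eq_one.2 h)
  rcases (accordion_adj.1 (N.adj_sub h)).2 with hr | hr
  · exact key v w h hr
  · exact (key w v h.symm hr).symm

theorem mem_coordSet_iff_partner [NeZero n] {N : (accordion n k).Subgraph}
    {P : Bool → AddSubgroup.zmultiples (k : ZMod n) → ℕ → Prop} (hP : IsCoordInvariant N P)
    (hg : 5 ≤ n.gcd k) (v : Bool × ZMod n) :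
    v ∈ coordSet n k P ↔ partner n k v ∈ coordSet n k P := by
  obtain ⟨t, i⟩ := v
  obtain ⟨b, j, hj, rfl⟩ := exists_coord (k := k) i
  have hrung : (t, (b : ZMod n)) ∈ coordSet n k P ↔ (t, (b : ZMod n) + 1) ∈ coordSet n k P := by
    have h0 := mem_coordSet (P := P) (t := t) (b := b) (j := 0) (by omega)
    have h1 := mem_coordSet (P := P) (t := t) (b := b) (j := 1) (by omega)
    rw [Nat.cast_zero, add_zero] at h0
    rw [Nat.cast_one] at h1
    rw [h0, h1, hP.rung]
  obtain rfl | rfl | h2 : j = 0 ∨ j = 1 ∨ 2 ≤ j := by omega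
  · simpa [partner_zero hg] using hrung
  · simpa [partner_one hg] using hrung.symm
  · by_cases hE : Even j
    · rw [partner_even _ b h2 hj hE, mem_coordSet hj, mem_coordSet hj]
      have := hP.even b j h2 hj hE
      cases t
      · exact this
      · exact this.symm
    · rw [partner_odd _ b h2 hj hE, mem_coordSet hj]
      cases t
      · have h0 : (b : ZMod n) + j + k =
            (b + gen n k : AddSubgroup.zmultiples (k : ZMod n)) + j := by
          rw [AddSubgroup.coe_add]
          ring
        simp only [Bool.not_false, Bool.false_eq_true, if_false]
        rw [h0, mem_coordSet hj]
        exact hP.odd b j h2 hj hE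
      · have h0 : (b : ZMod n) + j - k =
            (b - gen n k : AddSubgroup.zmultiples (k : ZMod n)) + j := by
          rw [AddSubgroup.coe_sub]
          ring
        simp only [Bool.not_true, if_true]
        rw [h0, mem_coordSet hj]
        have := hP.odd (b - gen n k) j h2 hj hE
        rw [sub_add_cancel] at this
        exact this.symm

end Accordion

/-- If `gcd(n,k) ≥ 5`, the accordion graph `A[n,k]` does not have the PMH-property. -/
theorem accordion_not_isPMH_of_five_le_gcd (n k : ℕ) (hn : 3 ≤ n) (hk : 0 < k)
    (hkn : 2 * k ≤ n) (hgcd : 5 ≤ Nat.gcd n k) : ¬ IsPMH (accordion n k) := by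
  intro hPMH
  have : NeZero n := ⟨by omega⟩
  obtain ⟨M, hM, hMadj⟩ := exists_isPerfectMatching_partner (k := k) hn hgcd
  obtain ⟨N, hN, v, c, hc, hMN⟩ := hPMH M hM
  by_cases hpartner : ∀ v, ¬ N.Adj v (partner n k v)
  · have hgrid := isGridMatching_edgeIndicator hn hk (by omega) hgcd hN hpartner
    obtain ⟨P, hP, ⟨t, b, j, hj, hPt⟩, t', b', j', hj', hPf⟩ :=
      hgrid.exists_isEdgeInvariant hgcd (by
        rintro ⟨b, hb⟩
        obtain ⟨z, rfl⟩ := AddSubgroup.mem_zmultiples_iff.1 hb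
        exact AddSubgroup.mem_zmultiples_iff.2 ⟨z, rfl⟩)
    refine hPf ((mem_coordSet hj').1 (hc.mem_of_closed hMN ?_ ?_ ((mem_coordSet hj).2 hPt) _))
    · intro a b hab
      rw [← (hMadj a b).1 hab]
      exact (mem_coordSet_iff_partner hP hgcd a).1
    · intro a b hab
      exact (mem_coordSet_iff_of_adj hP hgcd hab).1
  · push Not at hpartner
    obtain ⟨a, ha⟩ := hpartner
    have hclosed : ∀ w, w ∈ ({a, partner n k a} : Set (Bool × ZMod n)) := by
      refine hc.mem_of_closed hMN ?_ ?_ (Set.mem_insert a _)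
      · intro b d hbd
        rw [hMadj] at hbd
        rintro (rfl | rfl)
        · exact Or.inr hbd.symm
        · rw [partner_partner hgcd] at hbd
          exact Or.inl hbd.symm
      · intro b d hbd
        rintro (rfl | rfl)
        · exact Or.inr ((hN.1 (hN.2 b)).unique hbd ha)
        · exact Or.inl ((hN.1 (hN.2 _)).unique hbd ha.symm)
    have hcard := Set.ncard_le_ncard (fun w _ => hclosed w : Set.univ ⊆ _) (Set.toFinite _)
    rw [Set.ncard_univ, Nat.card_prod, Nat.card_zmod, Nat.card_eq_fintype_card,
      Fintype.card_bool] at hcard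
    have := Set.ncard_insert_le a {partner n k a}
    rw [Set.ncard_singleton] at this
    omega
end

section
/- Let n and k be integers with n ≥ 3 and 0 < k ≤ n/2. The accordion graph A[n,k] is bipartite if and only if n and k are both even. -/
open SimpleGraph

theorem accordion_adj_succ {n : ℕ} (k : ℕ) (hn : 2 ≤ n) (b : Bool) (i : ZMod n) :
    (accordion n k).Adj (b, i) (b, i + 1) := by
  have : Fact (1 < n) := ⟨hn⟩
  simp [accordion, SimpleGraph.fromRel_adj]

theorem accordion_adj_spoke (n k : ℕ) (i : ZMod n) :
    (accordion n k).Adj (false, i) (true, i) := by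
  simp [accordion, SimpleGraph.fromRel_adj]

theorem accordion_adj_shifted_spoke (n k : ℕ) (i : ZMod n) :
    (accordion n k).Adj (false, i) (true, i + k) := by
  simp [accordion, SimpleGraph.fromRel_adj]

/-- Along each of the two cycles of an accordion graph, a proper 2-colouring alternates. -/
theorem accordion_coloring_eq_iff_even {n k : ℕ} (hn : 2 ≤ n)
    (c : (accordion n k).Coloring Bool) (b : Bool) (m : ℕ) :
    c (b, (m : ZMod n)) = c (b, 0) ↔ Even m := by
  induction m with
  | zero => simp
  | succ m ih =>
    have h := c.valid (accordion_adj_succ k hn b (m : ZMod n))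
    rw [Nat.even_add_one, ← ih, Nat.cast_succ]
    revert h
    generalize c (b, (m : ZMod n)) = x
    generalize c (b, (m : ZMod n) + 1) = y
    generalize c (b, 0) = z
    revert x y z
    decide

theorem even_of_accordion_coloring {n k : ℕ} (hn : 2 ≤ n)
    (c : (accordion n k).Coloring Bool) : Even n ∧ Even k := by
  refine ⟨(accordion_coloring_eq_iff_even hn c false n).1 (by simp),
    (accordion_coloring_eq_iff_even hn c true k).1 ?_⟩
  have h₁ := c.valid (accordion_adj_spoke n k 0)
  have h₂ := c.valid (accordion_adj_shifted_spoke n k 0)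
  rw [zero_add] at h₂
  exact (Bool.eq_not.2 h₂.symm).trans (Bool.eq_not.2 h₁.symm).symm

theorem accordion_colorable_two_of_even {n k : ℕ} (hn : Even n) (hk : Even k) :
    (accordion n k).Colorable 2 := by
  let φ := ZMod.castHom hn.two_dvd (ZMod 2)
  have hφk : φ k = 0 := by
    rw [map_natCast, ZMod.natCast_eq_zero_iff_even.2 hk]
  let c : Bool × ZMod n → ZMod 2 := fun x => φ x.2 + if x.1 then 1 else 0
  have hc : ∀ x y : Bool × ZMod n, ((x.1 = y.1 ∧ y.2 = x.2 + 1) ∨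
      (x.1 = false ∧ y.1 = true ∧ (y.2 = x.2 ∨ y.2 = x.2 + (k : ZMod n)))) → c x ≠ c y := by
    rintro ⟨a, i⟩ ⟨b, j⟩ (⟨rfl, rfl⟩ | ⟨rfl, rfl, rfl | rfl⟩) <;>
      simp [c, hφk]
  let C : (accordion n k).Coloring (ZMod 2) := SimpleGraph.Coloring.mk c fun {x y} h => by
    rcases ((SimpleGraph.fromRel_adj _ x y).1 h).2 with h | h
    · exact hc x y h
    · exact (hc y x h).symm
  simpa using C.colorable

/-- For `n ≥ 3` and `0 < k ≤ n/2`, the accordion graph `A[n,k]` is bipartite iff both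
`n` and `k` are even. -/
theorem accordion_bipartite_iff (n k : ℕ) (hn : 3 ≤ n) (hk : 0 < k) (hkn : 2 * k ≤ n) :
    (accordion n k).Colorable 2 ↔ Even n ∧ Even k := by
  constructor
  · intro h
    obtain ⟨c⟩ : Nonempty ((accordion n k).Coloring Bool) :=
      ⟨h.toColoring (by simp)⟩
    exact even_of_accordion_coloring (by omega) c
  · rintro ⟨hn_even, hk_even⟩
    exact accordion_colorable_two_of_even hn_even hk_even
end

section
/- For every even integer n ≥ 4, the accordion graph A[n,2] is isomorphic to the quartic circulant graph Ci[2n,{1,n−1}]. Moreover, an explicit isomorphism is given by the map sending u_i to x_{1+(n−1)(i−1) (mod 2n)} for all i ∈ [n], sending v_1 to x_{2+n (mod 2n)}, and sending v_i to x_{2+(n−1)(i−1) (mod 2n)} for 2 ≤ i ≤ n. -/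
open SimpleGraph

/-- The quartic circulant graph `Ci[m,{a,b}]` on the vertex set `ZMod m`, where `x_i` is
adjacent to `x_{i±a}` and `x_{i±b}`. -/
def Ci (m a b : ℕ) : SimpleGraph (ZMod m) :=
  SimpleGraph.circulantGraph ({(a : ZMod m), (b : ZMod m)} : Set (ZMod m))

/-- The index in `{1, …, n}` represented by an element of `ZMod n`. -/
def paperIdx {n : ℕ} (i : ZMod n) : ℕ := if i.val = 0 then n else i.val

lemma ZMod.eq_add_natCast_iff_val {n k : ℕ} [NeZero n] (hk : k < n) (x y : ZMod n) :
    y = x + (k : ZMod n) ↔ y.val = x.val + k ∨ y.val + n = x.val + k := by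
  have hx := x.val_lt
  have hy := y.val_lt
  rw [← (ZMod.val_injective n).eq_iff, ZMod.val_add, ZMod.val_natCast_of_lt hk]
  rcases lt_or_ge (x.val + k) n with h | h
  · rw [Nat.mod_eq_of_lt h]
    omega
  · rw [Nat.mod_eq_sub_mod h, Nat.mod_eq_of_lt (by omega)]
    omega

lemma ZMod.intCast_eq_intCast_iff_of_abs_lt {N : ℕ} {d k : ℤ} (hd : |d| < N) (hk : 0 ≤ k)
    (hkN : k < N) : (d : ZMod N) = (k : ZMod N) ↔ d = k ∨ d = k - N := by
  rw [abs_lt] at hd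
  rw [ZMod.intCast_eq_intCast_iff_dvd_sub]
  constructor
  · rintro ⟨c, hc⟩
    have h1 : c < 2 := by nlinarith
    have h2 : -1 < c := by nlinarith
    have : c = 0 ∨ c = 1 := by omega
    rcases this with rfl | rfl <;> omega
  · rintro (rfl | rfl)
    · simp
    · simp

/-- The integer position in `{-1, …, 2n - 2}` of a vertex of `accordion n 2`; multiplying it by
`n - 1` gives the corresponding vertex of the circulant graph. -/
def accordionPos (n : ℕ) (p : Bool × ZMod n) : ℤ :=
  if p.1 then (if p.2.val = 1 then n - 2 else paperIdx p.2 - 3) else n - 2 + paperIdx p.2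

lemma abs_accordionPos_sub_lt {n : ℕ} (hn : 4 ≤ n) (p q : Bool × ZMod n) :
    |accordionPos n p - accordionPos n q| < (2 * n : ℕ) := by
  have : NeZero n := ⟨by omega⟩
  obtain ⟨a, x⟩ := p
  obtain ⟨b, y⟩ := q
  have hx := x.val_lt
  have hy := y.val_lt
  rw [abs_lt]
  unfold accordionPos paperIdx
  dsimp only
  generalize x.val = i at *
  generalize y.val = j at *
  cases a <;> cases b <;> simp <;> split_ifs <;> omega

lemma accordionPos_injective {n : ℕ} (hn : 4 ≤ n) : Function.Injective (accordionPos n) := by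
  have : NeZero n := ⟨by omega⟩
  rintro ⟨a, x⟩ ⟨b, y⟩ h
  have hx := x.val_lt
  have hy := y.val_lt
  rw [Prod.mk.injEq, ← (ZMod.val_injective n).eq_iff]
  unfold accordionPos paperIdx at h
  dsimp only at h
  generalize x.val = i at *
  generalize y.val = j at *
  cases a <;> cases b <;> simp at h ⊢ <;> split_ifs at h <;> omega

lemma accordion_two_adj_iff {n : ℕ} (hn : 4 ≤ n) (p q : Bool × ZMod n) :
    (accordion n 2).Adj p q ↔
      ∃ d ∈ ({accordionPos n p - accordionPos n q, accordionPos n q - accordionPos n p} : Set ℤ),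
        d = 1 ∨ d = n - 1 ∨ d = 1 - 2 * n ∨ d = -1 - n := by
  have : NeZero n := ⟨by omega⟩
  obtain ⟨a, x⟩ := p
  obtain ⟨b, y⟩ := q
  have hx := x.val_lt
  have hy := y.val_lt
  have key (z w : ZMod n) := ZMod.eq_add_natCast_iff_val (k := 1) (by omega) z w
  simp only [Nat.cast_one] at key
  simp only [accordion, SimpleGraph.fromRel_adj, ne_eq, Prod.mk.injEq, key,
    ZMod.eq_add_natCast_iff_val (k := 2) (by omega : 2 < n), ← (ZMod.val_injective n).eq_iff,
    Set.mem_insert_iff, Set.mem_singleton_iff, exists_eq_or_imp, exists_eq_left]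
  unfold accordionPos paperIdx
  dsimp only
  clear key
  generalize x.val = i at *
  generalize y.val = j at *
  cases a <;> cases b <;> simp <;> split_ifs <;> omega

lemma natCast_sub_one_mul_self {n : ℕ} (hne : Even n) :
    ((n : ZMod (2 * n)) - 1) * ((n : ZMod (2 * n)) - 1) = 1 := by
  have h2 : (2 : ZMod (2 * n)) * n = 0 := by exact_mod_cast ZMod.natCast_self (2 * n)
  obtain ⟨k, hk⟩ := hne
  have hk' : (n : ZMod (2 * n)) = k + k := by rw [← Nat.cast_add, ← hk]
  linear_combination ((k : ZMod (2 * n)) - 1) * h2 + (n : ZMod (2 * n)) * hk'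

lemma Ci_adj_iff {n : ℕ} (hn : 4 ≤ n) (hne : Even n) {s t : ℤ} (h : |s - t| < (2 * n : ℕ)) :
    (Ci (2 * n) 1 (n - 1)).Adj (((n : ZMod (2 * n)) - 1) * s) (((n : ZMod (2 * n)) - 1) * t) ↔
      ∃ d ∈ ({s - t, t - s} : Set ℤ), d = 1 ∨ d = n - 1 ∨ d = 1 - 2 * n ∨ d = -1 - n := by
  have hm := natCast_sub_one_mul_self hne
  have cancel (a b : ZMod (2 * n)) :
      ((n : ZMod (2 * n)) - 1) * a = b ↔ a = ((n : ZMod (2 * n)) - 1) * b := by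
    constructor
    · rintro rfl
      rw [← mul_assoc, hm, one_mul]
    · rintro rfl
      rw [← mul_assoc, hm, one_mul]
  have mem (a b : ℤ) (hab : |a - b| < (2 * n : ℕ)) :
      ((n : ZMod (2 * n)) - 1) * a - ((n : ZMod (2 * n)) - 1) * b ∈
        ({((1 : ℕ) : ZMod (2 * n)), ((n - 1 : ℕ) : ZMod (2 * n))} : Set (ZMod (2 * n))) ↔
      a - b = 1 ∨ a - b = n - 1 ∨ a - b = 1 - 2 * n ∨ a - b = -1 - n := by
    have h1 := ZMod.intCast_eq_intCast_iff_of_abs_lt (k := 1) hab (by omega) (by omega)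
    have h2 := ZMod.intCast_eq_intCast_iff_of_abs_lt (k := n - 1) hab (by omega) (by omega)
    push_cast at h1 h2
    rw [Set.mem_insert_iff, Set.mem_singleton_iff, ← mul_sub, cancel, cancel,
      Nat.cast_sub (by omega : 1 ≤ n), Nat.cast_one, hm, mul_one, h1, h2]
    omega
  have hne' : ((n : ZMod (2 * n)) - 1) * s = ((n : ZMod (2 * n)) - 1) * t ↔ s = t := by
    have h0 := ZMod.intCast_eq_intCast_iff_of_abs_lt (k := 0) h (by omega) (by omega)
    rw [cancel, ← mul_assoc, hm, one_mul, ← sub_eq_zero]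
    push_cast at h0
    rw [h0]
    rw [abs_lt] at h
    omega
  have h' : |t - s| < (2 * n : ℕ) := by rwa [abs_sub_comm]
  rw [Ci, circulantGraph, SimpleGraph.fromRel_adj, ne_eq, hne', mem s t h, mem t s h']
  simp only [Set.mem_insert_iff, Set.mem_singleton_iff, exists_eq_or_imp, exists_eq_left]
  omega

/-- For every even `n ≥ 4`, the accordion graph `A[n,2]` is isomorphic to the quartic
circulant graph `Ci[2n,{1,n-1}]`, via the explicit isomorphism sending `u_i` to
`x_{1+(n-1)(i-1) mod 2n}` for all `i ∈ [n]`, `v_1` to `x_{2+n mod 2n}`, and `v_i` to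
`x_{2+(n-1)(i-1) mod 2n}` for `2 ≤ i ≤ n`. -/
theorem accordion_two_iso_circulant (n : ℕ) (hn : 4 ≤ n) (hne : Even n) :
    ∃ φ : accordion n 2 ≃g Ci (2 * n) 1 (n - 1),
      (∀ i : ZMod n, φ (false, i) = ((1 + (n - 1) * (paperIdx i - 1) : ℕ) : ZMod (2 * n))) ∧
      (φ (true, 1) = ((2 + n : ℕ) : ZMod (2 * n))) ∧
      (∀ i : ZMod n, i ≠ 1 →
        φ (true, i) = ((2 + (n - 1) * (paperIdx i - 1) : ℕ) : ZMod (2 * n))) := by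
  have : NeZero n := ⟨by omega⟩
  have : Fact (1 < n) := ⟨by omega⟩
  have hm := natCast_sub_one_mul_self hne
  have h2 : (2 : ZMod (2 * n)) * n = 0 := by exact_mod_cast ZMod.natCast_self (2 * n)
  have hidx (i : ZMod n) : 1 ≤ paperIdx i := by
    unfold paperIdx
    split_ifs <;> omega
  let f (p : Bool × ZMod n) : ZMod (2 * n) := ((n : ZMod (2 * n)) - 1) * (accordionPos n p : ℤ)
  have hf : Function.Injective f := by
    intro p q hpq
    apply accordionPos_injective hn
    have heq : ((accordionPos n p : ℤ) : ZMod (2 * n)) = (accordionPos n q : ℤ) := by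
      have := congrArg (((n : ZMod (2 * n)) - 1) * ·) hpq
      simpa only [f, ← mul_assoc, hm, one_mul] using this
    have hlt := abs_accordionPos_sub_lt hn p q
    have h0 := ZMod.intCast_eq_intCast_iff_of_abs_lt (k := 0) hlt (by omega) (by omega)
    rw [Int.cast_sub, heq, sub_self, Int.cast_zero] at h0
    have := h0.1 rfl
    rw [abs_lt] at hlt
    omega
  have hbij : Function.Bijective f := by
    rw [Fintype.bijective_iff_injective_and_card]
    exact ⟨hf, by simp [ZMod.card]⟩
  refine ⟨⟨Equiv.ofBijective f hbij, ?_⟩, ?_, ?_, ?_⟩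
  · intro p q
    exact (Ci_adj_iff hn hne (abs_accordionPos_sub_lt hn p q)).trans
      (accordion_two_adj_iff hn p q).symm
  · intro i
    change ((n : ZMod (2 * n)) - 1) * (accordionPos n (false, i) : ℤ) = _
    simp only [accordionPos, Bool.false_eq_true, if_false]
    push_cast [Nat.cast_sub (hidx i), Nat.cast_sub (by omega : 1 ≤ n)]
    linear_combination hm
  · change ((n : ZMod (2 * n)) - 1) * (accordionPos n (true, 1) : ℤ) = _
    simp only [accordionPos, if_true, ZMod.val_one]
    push_cast
    linear_combination hm - h2
  · intro i hi
    have hi' : i.val ≠ 1 := by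
      rwa [← ZMod.val_one n, ne_eq, (ZMod.val_injective n).eq_iff]
    change ((n : ZMod (2 * n)) - 1) * (accordionPos n (true, i) : ℤ) = _
    simp only [accordionPos, if_true, hi', if_false]
    push_cast [Nat.cast_sub (hidx i), Nat.cast_sub (by omega : 1 ≤ n)]
    linear_combination -h2
end

section
/- Let n and k be even integers with n ≥ 4 and 0 < k ≤ n/2. The accordion graph A[n,k] is a circulant graph (i.e., isomorphic to a Cayley graph of the cyclic group Z_{2n}) if and only if k = 2. -/
open SimpleGraph

/-- A graph on `2n` vertices is circulant if it is isomorphic to a circulant graph on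
the cyclic group `ZMod (2n)`. -/
def IsCirculant {V : Type} (m : ℕ) (G : SimpleGraph V) : Prop :=
  ∃ s : Set (ZMod m), Nonempty (G ≃g SimpleGraph.circulantGraph s)

theorem accordion_adj_same {n k : ℕ} (h1 : (1 : ZMod n) ≠ 0) (b : Bool) (i j : ZMod n) :
    (accordion n k).Adj (b, i) (b, j) ↔ j = i + 1 ∨ i = j + 1 := by
  cases b <;> simp only [accordion, fromRel_adj, ne_eq, Prod.mk.injEq] <;>
    grind

theorem accordion_adj_false_true {n k : ℕ} (i j : ZMod n) :
    (accordion n k).Adj (false, i) (true, j) ↔ j = i ∨ j = i + k := by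
  simp [accordion]

/-- In a circulant graph, completing a path `q, r, p` to a parallelogram gives a common
neighbour `p + q - r` of `p` and `q`. -/
theorem circulantGraph_adj_parallelogram {G : Type*} [AddCommGroup G] {s : Set G} {p q r : G}
    (hq : (circulantGraph s).Adj q r) : (circulantGraph s).Adj (p + q - r) p := by
  have h := (circulantGraph_adj_translate (s := s) (d := p - r)).2 hq
  convert h using 1 <;> abel

theorem add_eq_two_mul_of_unique_common_neighbor {V R : Type*} [CommRing R] {G : SimpleGraph V}
    {s : Set R} (g : G ≃g circulantGraph s) {x y z : V} (hy : G.Adj y x) (hz : G.Adj z x)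
    (h : ∀ w, G.Adj w y → G.Adj w z → w = x) : g y + g z = 2 * g x := by
  obtain ⟨w, hw⟩ := g.surjective (g y + g z - g x)
  have h1 : G.Adj w y := by
    rw [← g.map_adj_iff, hw]
    exact circulantGraph_adj_parallelogram (g.map_adj_iff.2 hz)
  have h2 : G.Adj w z := by
    rw [← g.map_adj_iff, hw, add_comm]
    exact circulantGraph_adj_parallelogram (g.map_adj_iff.2 hy)
  rw [h w h1 h2] at hw
  linear_combination -hw

theorem eq_add_mul_of_second_difference {R : Type*} [CommRing R] {n : ℕ} (f : ZMod n → R)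
    (h : ∀ i, f (i + 1) + f (i - 1) = 2 * f i) (m : ℕ) :
    f m = f 0 + m * (f 1 - f 0) := by
  induction m using Nat.twoStepInduction with
  | zero => simp
  | one => simp
  | more m h0 h1 =>
    have := h ((m + 1 : ℕ) : ZMod n)
    rw [h1] at this
    push_cast at this h0 ⊢
    rw [add_sub_cancel_right, h0, add_assoc, one_add_one_eq_two] at this
    linear_combination this

theorem even_of_natCast_mul_eq_zero {n : ℕ} (hn : 0 < n) {a : ZMod (2 * n)}
    (h : (n : ZMod (2 * n)) * a = 0) : ∃ c, a = 2 * c := by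
  have : NeZero (2 * n) := ⟨by omega⟩
  rw [← ZMod.natCast_zmod_val a, ← Nat.cast_mul, ZMod.natCast_eq_zero_iff] at h
  obtain ⟨c, hc⟩ : 2 ∣ a.val := by
    refine Nat.dvd_of_mul_dvd_mul_left hn ?_
    rwa [mul_comm n 2]
  exact ⟨c, by rw [← ZMod.natCast_zmod_val a, hc]; push_cast; rfl⟩

theorem even_of_two_mul_eq_zero {n : ℕ} (hn : 0 < n) (hne : Even n) {a : ZMod (2 * n)}
    (h : 2 * a = 0) : ∃ c, a = 2 * c := by
  apply even_of_natCast_mul_eq_zero hn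
  obtain ⟨t, rfl⟩ := hne
  push_cast
  linear_combination (t : ZMod (2 * (t + t))) * h

theorem one_ne_two_mul {n : ℕ} (c : ZMod (2 * n)) : 1 ≠ 2 * c := by
  intro h
  have := congrArg (ZMod.castHom (Nat.dvd_mul_right 2 n) (ZMod 2)) h
  rw [map_one, map_mul, map_ofNat] at this
  generalize ZMod.castHom (Nat.dvd_mul_right 2 n) (ZMod 2) c = d at this
  revert d
  decide

theorem accordion_row_eq {n k : ℕ} {s : Set (ZMod (2 * n))} (hk : 4 ≤ k) (hkn : 2 * k ≤ n)
    (g : accordion n k ≃g circulantGraph s) (b : Bool) :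
    ∃ c, ∀ i : ZMod n, g (b, i) = g (b, 0) + i.val * (2 * c) := by
  have hne (m : ℕ) (h0 : 0 < m) (hm : m < n) : (m : ZMod n) ≠ 0 := by
    rw [ne_eq, ZMod.natCast_eq_zero_iff]
    exact Nat.not_dvd_of_pos_of_lt h0 hm
  have : NeZero n := ⟨by omega⟩
  have h1 : (1 : ZMod n) ≠ 0 := by simpa using hne 1 (by omega) (by omega)
  have h2 : (2 : ZMod n) ≠ 0 := by simpa using hne 2 (by omega) (by omega)
  have h4 : (4 : ZMod n) ≠ 0 := by simpa using hne 4 (by omega) (by omega)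
  have hk2 : (k : ZMod n) + 2 ≠ 0 := by simpa using hne (k + 2) (by omega) (by omega)
  have hk2' : (k : ZMod n) - 2 ≠ 0 := by
    simpa [Nat.cast_sub (show 2 ≤ k by omega)] using hne (k - 2) (by omega) (by omega)
  have hlin : ∀ i, g (b, i + 1) + g (b, i - 1) = 2 * g (b, i) := by
    intro i
    apply add_eq_two_mul_of_unique_common_neighbor g
    · rw [accordion_adj_same h1]; simp
    · rw [accordion_adj_same h1]; simp
    · have h2i : i + 1 ≠ i - 1 := fun h => h2 (by linear_combination h)
      have h2k : i + 1 + (k : ZMod n) ≠ i - 1 + k := fun h => h2 (by linear_combination h)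
      have h4i : i - 1 ≠ i + 1 + 1 + 1 := fun h => h4 (by linear_combination -h)
      rintro ⟨b', j⟩ hy hz
      cases b <;> cases b' <;>
        simp only [accordion_adj_same h1, accordion_adj_false_true,
          (accordion n k).adj_comm (true, _) (false, _)] at hy hz <;> grind
  have key := eq_add_mul_of_second_difference (fun i => g (b, i)) hlin
  have hz := key n
  simp only [ZMod.natCast_self, left_eq_add] at hz
  obtain ⟨c, hc⟩ := even_of_natCast_mul_eq_zero (by omega) hz
  refine ⟨c, fun i => ?_⟩
  rw [← hc, ← key, ZMod.natCast_zmod_val]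

theorem not_isCirculant_accordion {n k : ℕ} (hk : 4 ≤ k) (hkn : 2 * k ≤ n) (hne : Even n)
    (hke : Even k) : ¬ IsCirculant (2 * n) (accordion n k) := by
  rintro ⟨s, ⟨g⟩⟩
  have : Fact (1 < n) := ⟨by omega⟩
  have : NeZero n := ⟨by omega⟩
  obtain ⟨c, hc⟩ := accordion_row_eq hk hkn g false
  obtain ⟨d, hd⟩ := accordion_row_eq hk hkn g true
  set p := g (false, 0)
  set q := g (true, 0)
  have hodd : ∀ e, q - p ≠ 2 * e := by
    intro e he
    obtain ⟨⟨b, i⟩, hw⟩ := g.surjective (p + 1)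
    cases b
    · rw [hc] at hw
      exact one_ne_two_mul ((i.val : ZMod (2 * n)) * c) (by linear_combination -hw)
    · rw [hd] at hw
      exact one_ne_two_mul (e + (i.val : ZMod (2 * n)) * d) (by linear_combination -hw + he)
  obtain ⟨⟨b, i⟩, hw⟩ := g.surjective (2 * p - q)
  have hadj : (accordion n k).Adj (false, 0) (b, i) := by
    rw [← g.map_adj_iff, hw]
    have : (accordion n k).Adj (false, 0) (true, 0) := by simp [accordion_adj_false_true]
    have := circulantGraph_adj_parallelogram (p := p) (g.map_adj_iff.2 this)
    simpa only [two_mul] using this.symm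
  cases b
  · rw [hc] at hw
    exact hodd (-(i.val * c)) (by linear_combination hw)
  · have hik : ∃ t, (i.val : ZMod (2 * n)) = 2 * t := by
      rw [accordion_adj_false_true] at hadj
      rcases hadj with rfl | rfl
      · exact ⟨0, by simp⟩
      · obtain ⟨t, rfl⟩ := hke
        exact ⟨t, by rw [zero_add, ZMod.val_natCast_of_lt (by omega)]; push_cast; ring⟩
    obtain ⟨t, ht⟩ := hik
    rw [hd] at hw
    obtain ⟨e, he⟩ := even_of_two_mul_eq_zero (by omega) hne
      (a := q - p + i.val * d) (by linear_combination hw)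
    exact hodd (e - t * d) (by linear_combination he - d * ht)

theorem isCirculant_accordion_two {n : ℕ} (hn : 2 ≤ n) :
    IsCirculant (2 * n) (accordion n 2) := by
  have : Fact (1 < n) := ⟨hn⟩
  have : NeZero n := ⟨by omega⟩
  have : NeZero (2 * n) := ⟨by omega⟩
  let π := ZMod.castHom (Dvd.intro_left 2 rfl : n ∣ 2 * n) (ZMod n)
  let f : Bool × ZMod n → ZMod (2 * n) := fun x =>
    bif x.1 then ((x.2 - 1).val : ZMod (2 * n)) + n else (x.2.val : ZMod (2 * n))
  have hf0 (i : ZMod n) : π (f (false, i)) = i := by simp [f, π]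
  have hf1 (i : ZMod n) : π (f (true, i)) = i - 1 := by
    simp only [f, cond_true, map_add, map_natCast, ZMod.natCast_zmod_val, ZMod.natCast_self,
      add_zero]
  have hn0 : (n : ZMod (2 * n)) ≠ 0 := by
    rw [ne_eq, ZMod.natCast_eq_zero_iff]
    exact Nat.not_dvd_of_pos_of_lt (by omega) (by omega)
  have hne (i j : ZMod n) : f (false, i) ≠ f (true, j) := by
    intro h
    have h' := congrArg π h
    rw [hf0, hf1] at h'
    subst h'
    simp [f, hn0] at h
  have hinj : Function.Injective f := by
    rintro ⟨b, i⟩ ⟨b', j⟩ h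
    have h' := congrArg π h
    cases b <;> cases b'
    · rw [hf0, hf0] at h'; rw [h']
    · exact absurd h (hne i j)
    · exact absurd h.symm (hne j i)
    · rw [hf1, hf1, sub_left_inj] at h'; rw [h']
  have hbij : Function.Bijective f :=
    (Fintype.bijective_iff_injective_and_card f).2 ⟨hinj, by simp [ZMod.card]⟩
  refine ⟨{x | π x = 1 ∨ π x = -1}, ⟨⟨Equiv.ofBijective f hbij, ?_⟩⟩⟩
  have h1 : (1 : ZMod n) ≠ 0 := one_ne_zero
  rintro ⟨b, i⟩ ⟨b', j⟩
  simp only [Equiv.ofBijective_apply, circulantGraph_adj, Set.mem_ofPred_eq, map_sub, hinj.eq_iff]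
  cases b <;> cases b' <;>
    simp only [hf0, hf1, accordion_adj_same h1, accordion_adj_false_true,
      (accordion n 2).adj_comm (true, _) (false, _), Nat.cast_ofNat, Prod.mk.injEq] <;>
    grind

/-- For `n` and `k` even with `n ≥ 4` and `0 < k ≤ n/2`, the accordion graph `A[n,k]`
is circulant iff `k = 2`. -/
theorem accordion_even_isCirculant_iff (n k : ℕ) (hn : 4 ≤ n) (hk : 0 < k)
    (hkn : 2 * k ≤ n) (hne : Even n) (hke : Even k) :
    IsCirculant (2 * n) (accordion n k) ↔ k = 2 := by
  constructor
  · intro h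
    by_contra hk2
    refine not_isCirculant_accordion ?_ hkn hne hke h
    obtain ⟨t, rfl⟩ := hke
    omega
  · rintro rfl
    exact isCirculant_accordion_two (by omega)
end

section
/- Let n and k be integers with n ≥ 3 and 0 < k ≤ n/2, and suppose k is odd. Then the accordion graph A[n,k] is isomorphic to the quartic circulant graph Ci[2n,{2,k}]; an explicit isomorphism is given by the map sending u_i to x_{2i} and v_i to x_{2i−k (mod 2n)} for all i ∈ [n]. -/
open SimpleGraph

/-- Doubling, as an additive homomorphism `ZMod n →+ ZMod (2 * n)`. -/
def ZMod.doubling (n : ℕ) : ZMod n →+ ZMod (2 * n) :=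
  ZMod.lift n ⟨(AddMonoidHom.mulLeft (2 : ZMod (2 * n))).comp (Int.castAddHom _), by
    simpa using mod_cast ZMod.natCast_self (2 * n)⟩

lemma ZMod.doubling_natCast (n a : ℕ) :
    ZMod.doubling n (a : ZMod n) = 2 * (a : ZMod (2 * n)) := by
  rw [ZMod.doubling, ← Int.cast_natCast (R := ZMod n), ZMod.lift_coe]
  simp

lemma ZMod.doubling_apply (n : ℕ) [NeZero n] (i : ZMod n) :
    ZMod.doubling n i = ((2 * i.val : ℕ) : ZMod (2 * n)) := by
  conv_lhs => rw [← ZMod.natCast_zmod_val i]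
  rw [ZMod.doubling_natCast]
  push_cast
  rfl

lemma ZMod.doubling_one (n : ℕ) : ZMod.doubling n 1 = 2 := by
  simpa using ZMod.doubling_natCast n 1

lemma ZMod.doubling_injective (n : ℕ) [NeZero n] : Function.Injective (ZMod.doubling n) := by
  rw [injective_iff_map_eq_zero]
  intro i hi
  rw [ZMod.doubling_apply, ZMod.natCast_eq_zero_iff] at hi
  rw [← ZMod.natCast_zmod_val i, ZMod.natCast_eq_zero_iff]
  exact Nat.dvd_of_mul_dvd_mul_left two_pos hi

lemma ZMod.doubling_ne_natCast_of_odd (n : ℕ) [NeZero n] {k : ℕ} (hk : Odd k) (i : ZMod n) :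
    ZMod.doubling n i ≠ (k : ZMod (2 * n)) := by
  intro h
  rw [ZMod.doubling_apply] at h
  have h2 := congrArg (ZMod.castHom (dvd_mul_right 2 n) (ZMod 2)) h
  rw [map_natCast, map_natCast, ZMod.natCast_eq_natCast_iff'] at h2
  have := Nat.odd_iff.mp hk
  omega

/-- The map `u_i ↦ x_{2i}`, `v_i ↦ x_{2i-k}`. -/
def accordionToCirculant (n k : ℕ) (x : Bool × ZMod n) : ZMod (2 * n) :=
  ZMod.doubling n x.2 - if x.1 then (k : ZMod (2 * n)) else 0

lemma accordionToCirculant_bijective (n : ℕ) [NeZero n] {k : ℕ} (hk : Odd k) :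
    Function.Bijective (accordionToCirculant n k) := by
  have : NeZero (2 * n) := ⟨mul_ne_zero two_ne_zero (NeZero.ne n)⟩
  rw [Fintype.bijective_iff_injective_and_card]
  refine ⟨?_, by simp [ZMod.card]⟩
  rintro ⟨_ | _, i⟩ ⟨_ | _, j⟩ h <;> simp only [accordionToCirculant] at h
  · simpa using ZMod.doubling_injective n (by simpa using h)
  · refine (ZMod.doubling_ne_natCast_of_odd n hk (j - i) ?_).elim
    rw [map_sub]
    simp at h
    linear_combination -h
  · refine (ZMod.doubling_ne_natCast_of_odd n hk (i - j) ?_).elim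
    rw [map_sub]
    simp at h
    linear_combination h
  · simpa using ZMod.doubling_injective n (by simpa using h)

lemma ZMod.doubling_sub_eq_two_iff (n : ℕ) [NeZero n] (i j : ZMod n) :
    ZMod.doubling n i - ZMod.doubling n j = 2 ↔ i = j + 1 := by
  rw [sub_eq_iff_eq_add', ← ZMod.doubling_one, ← map_add, (ZMod.doubling_injective n).eq_iff]

lemma ci_adj_accordionToCirculant_u_v (n : ℕ) [NeZero n] {k : ℕ} (hk : Odd k) (i j : ZMod n) :
    (Ci (2 * n) 2 k).Adj (accordionToCirculant n k (false, i)) (accordionToCirculant n k (true, j)) ↔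
      j = i ∨ j = i + k := by
  have hne : accordionToCirculant n k (false, i) ≠ accordionToCirculant n k (true, j) :=
    (accordionToCirculant_bijective n hk).1.ne (by simp)
  have h1 := ZMod.doubling_ne_natCast_of_odd n hk (j - i + 1)
  have h2 := ZMod.doubling_ne_natCast_of_odd n hk (j - i - 1)
  have h3 : ZMod.doubling n j = ZMod.doubling n i ↔ j = i := (ZMod.doubling_injective n).eq_iff
  have h4 : ZMod.doubling n j = ZMod.doubling n (i + k) ↔ j = i + k :=
    (ZMod.doubling_injective n).eq_iff
  rw [map_add, map_sub, ZMod.doubling_one] at h1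
  rw [map_sub, map_sub, ZMod.doubling_one] at h2
  rw [map_add, ZMod.doubling_natCast] at h4
  rw [← h3, ← h4]
  simp only [Ci, circulantGraph, fromRel_adj, hne, ne_eq, not_false_eq_true, true_and,
    Set.mem_insert_iff, Set.mem_singleton_iff]
  simp only [accordionToCirculant, Nat.cast_ofNat]
  simp only [if_true, Bool.false_eq_true, if_false]
  grind

lemma ci_adj_accordionToCirculant_same (n : ℕ) [NeZero n] {k : ℕ} (hk : Odd k) (b : Bool)
    (i j : ZMod n) :
    (Ci (2 * n) 2 k).Adj (accordionToCirculant n k (b, i)) (accordionToCirculant n k (b, j)) ↔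
      i ≠ j ∧ (j = i + 1 ∨ i = j + 1) := by
  have h1 := ZMod.doubling_ne_natCast_of_odd n hk (i - j)
  have h2 := ZMod.doubling_ne_natCast_of_odd n hk (j - i)
  rw [map_sub] at h1 h2
  simp only [Ci, circulantGraph, fromRel_adj, (accordionToCirculant_bijective n hk).1.ne_iff,
    Set.mem_insert_iff, Set.mem_singleton_iff]
  simp only [accordionToCirculant, Nat.cast_ofNat, sub_sub_sub_cancel_right, h1, h2, or_false,
    ZMod.doubling_sub_eq_two_iff]
  simp [or_comm]

lemma ci_adj_accordionToCirculant_iff (n : ℕ) [NeZero n] {k : ℕ} (hk : Odd k)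
    (x y : Bool × ZMod n) :
    (Ci (2 * n) 2 k).Adj (accordionToCirculant n k x) (accordionToCirculant n k y) ↔
      (accordion n k).Adj x y := by
  obtain ⟨_ | _, i⟩ := x <;> obtain ⟨_ | _, j⟩ := y
  · simp [ci_adj_accordionToCirculant_same n hk, accordion]
  · simp [ci_adj_accordionToCirculant_u_v n hk, accordion]
  · rw [adj_comm]
    simp [ci_adj_accordionToCirculant_u_v n hk, accordion]
  · simp [ci_adj_accordionToCirculant_same n hk, accordion]

/-- For `n ≥ 3`, `0 < k ≤ n/2` and `k` odd, the accordion graph `A[n,k]` is isomorphic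
to the quartic circulant graph `Ci[2n,{2,k}]`, via the explicit isomorphism sending
`u_i` to `x_{2i mod 2n}` and `v_i` to `x_{2i-k mod 2n}` for all `i ∈ [n]`. -/
theorem accordion_odd_iso_circulant (n k : ℕ) (hn : 3 ≤ n) (hk : 0 < k)
    (hkn : 2 * k ≤ n) (hko : Odd k) :
    ∃ φ : accordion n k ≃g Ci (2 * n) 2 k,
      (∀ i : ZMod n, φ (false, i) = ((2 * i.val : ℕ) : ZMod (2 * n))) ∧
      (∀ i : ZMod n, φ (true, i) =
        ((2 * i.val : ℕ) : ZMod (2 * n)) - (k : ZMod (2 * n))) := by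
  have : NeZero n := ⟨by omega⟩
  refine ⟨⟨Equiv.ofBijective _ (accordionToCirculant_bijective n hko),
    ci_adj_accordionToCirculant_iff n hko _ _⟩, fun i => ?_, fun i => ?_⟩
  · change ZMod.doubling n i - (if false then _ else _) = _
    simp [ZMod.doubling_apply]
  · change ZMod.doubling n i - (if true then _ else _) = _
    simp [ZMod.doubling_apply]
end

section
/- Let n and k be integers with n ≥ 3 and 0 < k ≤ n/2, and suppose n is odd and k is even. Then the accordion graph A[n,k] is isomorphic to the quartic circulant graph Ci[2n,{2,n−k}]; an explicit isomorphism is given by the map sending u_i to x_{2i} and v_i to x_{2i+n−k (mod 2n)} for all i ∈ [n]. -/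
open SimpleGraph

/-- Doubling, as an additive map from `ZMod n` to `ZMod (2 * n)`. -/
def ZMod.double (n : ℕ) : ZMod n →+ ZMod (2 * n) :=
  ZMod.lift n ⟨zmultiplesHom (ZMod (2 * n)) 2, by
    have h : ((2 * n : ℕ) : ZMod (2 * n)) = 0 := ZMod.natCast_self _
    push_cast at h
    simpa [mul_comm] using h⟩

theorem ZMod.double_natCast (n m : ℕ) : ZMod.double n (m : ZMod n) = 2 * (m : ZMod (2 * n)) := by
  rw [← Int.cast_natCast (R := ZMod n), ZMod.double, ZMod.lift_coe]
  simp [mul_comm]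

theorem ZMod.double_one (n : ℕ) : ZMod.double n 1 = 2 := by
  simpa using ZMod.double_natCast n 1

theorem ZMod.double_apply (n : ℕ) [NeZero n] (i : ZMod n) :
    ZMod.double n i = ((2 * i.val : ℕ) : ZMod (2 * n)) := by
  conv_lhs => rw [← ZMod.natCast_zmod_val i]
  rw [ZMod.double_natCast]
  push_cast
  rfl

theorem ZMod.double_injective (n : ℕ) [NeZero n] : Function.Injective (ZMod.double n) := by
  intro i j h
  rw [ZMod.double_apply, ZMod.double_apply, ZMod.natCast_eq_natCast_iff'] at h
  have hi := i.val_lt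
  have hj := j.val_lt
  rw [Nat.mod_eq_of_lt (by lia), Nat.mod_eq_of_lt (by lia)] at h
  exact ZMod.val_injective n (by lia)

/-- Elements of `ZMod (2 * n)` in the image of doubling are not residues of odd numbers. -/
theorem ZMod.double_ne_natCast_of_odd (n : ℕ) [NeZero n] (i : ZMod n) {m : ℕ} (hm : Odd m) :
    ZMod.double n i ≠ (m : ZMod (2 * n)) := by
  intro h
  rw [ZMod.double_apply, ZMod.natCast_eq_natCast_iff] at h
  have h2 : 2 * i.val % 2 = m % 2 := h.of_mul_right n
  have := Nat.odd_iff.mp hm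
  lia

/-- For `n ≥ 3` odd, `0 < k ≤ n/2` even, the accordion graph `A[n,k]` is isomorphic to
the quartic circulant graph `Ci[2n,{2,n-k}]`, via the explicit isomorphism sending
`u_i` to `x_{2i mod 2n}` and `v_i` to `x_{2i+n-k mod 2n}` for all `i ∈ [n]`. -/
theorem accordion_odd_even_iso_circulant (n k : ℕ) (hn : 3 ≤ n) (hk : 0 < k)
    (hkn : 2 * k ≤ n) (hno : Odd n) (hke : Even k) :
    ∃ φ : accordion n k ≃g Ci (2 * n) 2 (n - k),
      (∀ i : ZMod n, φ (false, i) = ((2 * i.val : ℕ) : ZMod (2 * n))) ∧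
      (∀ i : ZMod n, φ (true, i) = ((2 * i.val + (n - k) : ℕ) : ZMod (2 * n))) := by
  have : NeZero n := ⟨by lia⟩
  set d := ZMod.double n
  set c : ZMod (2 * n) := ((n - k : ℕ) : ZMod (2 * n)) with hc
  have hodd : Odd (n - k) := Nat.Odd.sub_even (by lia) hno hke
  have hd : ∀ i j, d i = d j ↔ i = j := fun _ _ => (ZMod.double_injective n).eq_iff
  have hdc : ∀ i, d i ≠ c := fun i => ZMod.double_ne_natCast_of_odd n i hodd
  have hd1 : d 1 = 2 := ZMod.double_one n
  have hck : c + c = -d (k : ZMod n) := by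
    rw [show d (k : ZMod n) = 2 * (k : ZMod (2 * n)) from ZMod.double_natCast n k, hc,
      Nat.cast_sub (by lia)]
    have h : ((2 * n : ℕ) : ZMod (2 * n)) = 0 := ZMod.natCast_self _
    push_cast at h
    linear_combination h
  -- differences of images, according to which of the two cycles each vertex lies on
  have same_two : ∀ i j, d i - d j = 2 ↔ i = j + 1 := fun i j => by
    rw [← hd1, sub_eq_iff_eq_add', ← map_add, hd]
  have same_c : ∀ i j, d i - d j ≠ c := fun i j => by
    rw [← map_sub]; exact hdc _
  have up_two : ∀ i j, d i + c - d j ≠ 2 := fun i j h => hdc (1 + j - i) <| by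
    rw [map_sub, map_add, hd1]; linear_combination -h
  have up_c : ∀ i j, d i + c - d j = c ↔ i = j := fun i j => by
    rw [← hd]; constructor <;> intro h <;> linear_combination h
  have down_two : ∀ i j, d j - (d i + c) ≠ 2 := fun i j h => hdc (j - i - 1) <| by
    rw [map_sub, map_sub, hd1]; linear_combination h
  have down_c : ∀ i j, d j - (d i + c) = c ↔ i = j + k := fun i j => by
    rw [← hd, map_add]
    constructor <;> intro h <;> linear_combination -h - hck
  let f : Bool × ZMod n → ZMod (2 * n) := fun x => d x.2 + if x.1 then c else 0
  have hf : Function.Injective f := by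
    rintro ⟨_ | _, i⟩ ⟨_ | _, j⟩ h <;> simp only [f, if_true, Bool.false_eq_true, if_false,
      add_zero, add_left_inj, hd] at h
    · rw [h]
    · exact absurd (sub_eq_iff_eq_add'.mpr h) (same_c i j)
    · exact absurd (sub_eq_iff_eq_add'.mpr h.symm) (same_c j i)
    · rw [h]
  have hbij : Function.Bijective f :=
    (Fintype.bijective_iff_injective_and_card f).mpr ⟨hf, by simp [ZMod.card]⟩
  refine ⟨⟨Equiv.ofBijective f hbij, ?_⟩, fun i => ?_, fun i => ?_⟩
  · intro x y
    simp only [Equiv.ofBijective_apply, Ci, accordion, circulantGraph, fromRel_adj,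
      hf.ne_iff, Set.mem_insert_iff, Set.mem_singleton_iff, Nat.cast_ofNat, ← hc]
    refine and_congr_right fun _ => ?_
    obtain ⟨_ | _, i⟩ := x <;> obtain ⟨_ | _, j⟩ := y <;>
      simp [f, same_two, same_c, up_two, up_c, down_two, down_c, or_comm]
  · simpa [f] using ZMod.double_apply n i
  · simpa [f, hc] using ZMod.double_apply n i
end

section
/- Let n and k be integers with n ≥ 3 and 0 < k ≤ n/2, and let q = gcd(n,k). The graph obtained from the accordion graph A[n,k] by deleting the edge set {u_{tq} u_{tq+1}, v_{tq} v_{tq+1} : t ∈ {1,…,n/q}} (indices modulo n) is isomorphic to the Cartesian product C_{2n/q} □ P_q of the cycle of length 2n/q with the path on q vertices. -/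
open SimpleGraph

/-- The edges of `accordion n k` that remain after deletion, oriented; `φ` is meant to be
the reduction `ZMod n → ZMod q`. -/
def accordionArc (n k : ℕ) {q : ℕ} (φ : ZMod n →+* ZMod q) (x y : Bool × ZMod n) : Prop :=
  (x.1 = y.1 ∧ y.2 = x.2 + 1 ∧ φ x.2 ≠ 0) ∨
    (x.1 = false ∧ y.1 = true ∧ (y.2 = x.2 ∨ y.2 = x.2 + (k : ZMod n)))

lemma exists_natCast_mul_eq_iff {n q : ℕ} [NeZero n] (h : q ∣ n) (i : ZMod n) :
    (∃ t : ℕ, 1 ≤ t ∧ t ≤ n / q ∧ i = ((t * q : ℕ) : ZMod n)) ↔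
      ZMod.castHom h (ZMod q) i = 0 := by
  constructor
  · rintro ⟨t, -, -, rfl⟩
    rw [map_natCast, Nat.cast_mul, ZMod.natCast_self, mul_zero]
  · intro hi
    have hn : 0 < n := NeZero.pos n
    have hq : 0 < q := Nat.pos_of_dvd_of_pos h hn
    rw [← ZMod.natCast_zmod_val i, map_natCast, ZMod.natCast_eq_zero_iff] at hi
    obtain ⟨t, ht⟩ := hi
    have hlt := ZMod.val_lt i
    rcases Nat.eq_zero_or_pos t with rfl | htpos
    · refine ⟨n / q, Nat.div_pos (Nat.le_of_dvd hn h) hq, le_rfl, ?_⟩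
      rw [Nat.div_mul_cancel h, ZMod.natCast_self]
      exact (ZMod.val_eq_zero i).1 (by simpa using ht)
    · refine ⟨t, htpos, ?_, ?_⟩
      · rw [Nat.le_div_iff_mul_le hq, mul_comm, ← ht]
        exact hlt.le
      · rw [mul_comm, ← ht, ZMod.natCast_zmod_val]

lemma accordion_deleteEdges_adj {n k q : ℕ} (hn : 3 ≤ n) (h : q ∣ n) (x y : Bool × ZMod n) :
    ((accordion n k).deleteEdges
        {e | ∃ t : ℕ, 1 ≤ t ∧ t ≤ n / q ∧
          (e = s(((false, ((t * q : ℕ) : ZMod n)) : Bool × ZMod n),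
                 (false, ((t * q : ℕ) : ZMod n) + 1)) ∨
           e = s(((true, ((t * q : ℕ) : ZMod n)) : Bool × ZMod n),
                 (true, ((t * q : ℕ) : ZMod n) + 1)))}).Adj x y ↔
      accordionArc n k (ZMod.castHom h (ZMod q)) x y ∨
        accordionArc n k (ZMod.castHom h (ZMod q)) y x := by
  have : NeZero n := ⟨by omega⟩
  have : Fact (1 < n) := ⟨by omega⟩
  have h2 : (1 : ZMod n) + 1 ≠ 0 := by
    intro h0
    have h0' : ((2 : ℕ) : ZMod n) = 0 := by rw [← h0]; norm_num
    rw [ZMod.natCast_eq_zero_iff] at h0'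
    exact absurd (Nat.le_of_dvd two_pos h0') (by omega)
  have hD : ∀ e : Sym2 (Bool × ZMod n), (∃ t : ℕ, 1 ≤ t ∧ t ≤ n / q ∧
      (e = s(((false, ((t * q : ℕ) : ZMod n)) : Bool × ZMod n),
             (false, ((t * q : ℕ) : ZMod n) + 1)) ∨
       e = s(((true, ((t * q : ℕ) : ZMod n)) : Bool × ZMod n),
             (true, ((t * q : ℕ) : ZMod n) + 1)))) ↔
      ∃ b i, ZMod.castHom h (ZMod q) i = 0 ∧ e = s((b, i), (b, i + 1)) := by
    intro e
    simp_rw [← exists_natCast_mul_eq_iff h]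
    constructor
    · rintro ⟨t, h1, h2, rfl | rfl⟩
      · exact ⟨_, _, ⟨t, h1, h2, rfl⟩, rfl⟩
      · exact ⟨_, _, ⟨t, h1, h2, rfl⟩, rfl⟩
    · rintro ⟨b, i, ⟨t, h1, h2, rfl⟩, rfl⟩
      exact ⟨t, h1, h2, by cases b <;> simp⟩
  obtain ⟨a, i⟩ := x
  obtain ⟨b, j⟩ := y
  rw [SimpleGraph.deleteEdges_adj, Set.mem_ofPred_eq, hD, accordion, SimpleGraph.fromRel_adj]
  simp only [accordionArc, Sym2.eq_iff, Prod.mk.injEq]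
  constructor
  · rintro ⟨⟨-, (⟨rfl, rfl⟩ | hx) | (⟨rfl, rfl⟩ | hx)⟩, hd⟩
    · exact .inl (.inl ⟨rfl, rfl, fun h0 => hd ⟨_, _, h0, .inl ⟨⟨rfl, rfl⟩, rfl, rfl⟩⟩⟩)
    · exact .inl (.inr hx)
    · exact .inr (.inl ⟨rfl, rfl, fun h0 => hd ⟨_, _, h0, .inr ⟨⟨rfl, rfl⟩, rfl, rfl⟩⟩⟩)
    · exact .inr (.inr hx)
  · have hne : ∀ i : ZMod n, i ≠ i + 1 + 1 := fun i hi => h2 (by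
      rw [add_assoc] at hi; exact left_eq_add.1 hi)
    rintro ((⟨rfl, rfl, h0⟩ | ⟨rfl, rfl, hx⟩) | (⟨rfl, rfl, h0⟩ | ⟨rfl, rfl, hx⟩))
    · refine ⟨⟨by simp, .inl (.inl ⟨rfl, rfl⟩)⟩, ?_⟩
      rintro ⟨c, l, hl, ⟨⟨-, rfl⟩, -⟩ | ⟨⟨-, rfl⟩, -, h3⟩⟩
      · exact h0 hl
      · exact hne _ h3.symm
    · refine ⟨⟨by simp, .inl (.inr ⟨rfl, rfl, hx⟩)⟩, ?_⟩
      rintro ⟨c, l, hl, ⟨⟨rfl, -⟩, h3, -⟩ | ⟨⟨rfl, -⟩, h3, -⟩⟩ <;> simp at h3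
    · refine ⟨⟨by simp, .inr (.inl ⟨rfl, rfl⟩)⟩, ?_⟩
      rintro ⟨c, l, hl, ⟨⟨-, h3⟩, -, rfl⟩ | ⟨⟨-, -⟩, -, rfl⟩⟩
      · exact hne _ h3.symm
      · exact h0 hl
    · refine ⟨⟨by simp, .inr (.inr ⟨rfl, rfl, hx⟩)⟩, ?_⟩
      rintro ⟨c, l, hl, ⟨⟨rfl, -⟩, h3, -⟩ | ⟨⟨rfl, -⟩, h3, -⟩⟩ <;> simp at h3

lemma cycleGraph_adj_iff_modEq {N : ℕ} (hN : 2 ≤ N) (a b : Fin N) :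
    (cycleGraph N).Adj a b ↔ (b : ℕ) ≡ a + 1 [MOD N] ∨ (a : ℕ) ≡ b + 1 [MOD N] := by
  have key : ∀ a b : Fin N, (b - a).val = 1 ↔ (b : ℕ) ≡ a + 1 [MOD N] := by
    intro a b
    have ha := a.isLt
    have hb := b.isLt
    rw [Fin.sub_def, Nat.ModEq, Nat.mod_eq_of_lt hb]
    dsimp only
    rcases Nat.lt_or_ge (a.val + 1) N with h1 | h1
    · rw [Nat.mod_eq_of_lt h1]
      rcases Nat.lt_or_ge b.val a.val with h2 | h2
      · rw [Nat.mod_eq_of_lt (by omega)]; omega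
      · rw [Nat.mod_eq_sub_mod (by omega), Nat.mod_eq_of_lt (by omega)]; omega
    · have h3 : a.val + 1 = N := by omega
      rw [h3, Nat.mod_self]
      rcases Nat.lt_or_ge b.val a.val with h2 | h2
      · rw [Nat.mod_eq_of_lt (by omega)]; omega
      · rw [Nat.mod_eq_sub_mod (by omega), Nat.mod_eq_of_lt (by omega)]; omega
  rw [cycleGraph_adj', key, key, or_comm]

/-- The vertex of `accordion n k` in column `p` reached after `c` steps along the cycle
`u_{p+1}, v_{p+1+k}, u_{p+1+k}, v_{p+1+2k}, …`. -/
def accordionVertex (n k c p : ℕ) : Bool × ZMod n :=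
  (c.bodd, ((p + 1 + k * ((c + 1) / 2) : ℕ) : ZMod n))

lemma accordionVertex_succ_right (n k c p : ℕ) :
    accordionVertex n k c (p + 1) =
      ((accordionVertex n k c p).1, (accordionVertex n k c p).2 + 1) := by
  simp only [accordionVertex, Prod.mk.injEq, true_and]
  push_cast
  ring

lemma accordionVertex_succ_left_of_odd {n k c p : ℕ} (hc : (accordionVertex n k c p).1 = true) :
    accordionVertex n k (c + 1) p = (false, (accordionVertex n k c p).2) := by
  have hc' : c.bodd = true := hc
  have h := Nat.mod_two_of_bodd c
  rw [hc'] at h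
  have : (c + 1 + 1) / 2 = (c + 1) / 2 := by simp at h; omega
  simp [accordionVertex, hc', this]

lemma accordionVertex_succ_left_of_even {n k c p : ℕ}
    (hc : (accordionVertex n k c p).1 = false) :
    accordionVertex n k (c + 1) p = (true, (accordionVertex n k c p).2 + k) := by
  have hc' : c.bodd = false := hc
  have h := Nat.mod_two_of_bodd c
  rw [hc'] at h
  have : (c + 1 + 1) / 2 = (c + 1) / 2 + 1 := by simp at h; omega
  simp only [accordionVertex, hc', this, Nat.bodd_succ, Bool.not_false, Prod.mk.injEq, true_and]
  push_cast
  ring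

lemma castHom_accordionVertex {n k q : ℕ} (h : q ∣ n) (hk : q ∣ k) (c p : ℕ) :
    ZMod.castHom h (ZMod q) (accordionVertex n k c p).2 = ((p + 1 : ℕ) : ZMod q) := by
  have : ((k : ℕ) : ZMod q) = 0 := (ZMod.natCast_eq_zero_iff _ _).2 hk
  rw [accordionVertex, map_natCast]
  push_cast
  rw [this]
  ring

lemma accordionVertex_eq_iff {n k c c' p : ℕ} (hn : 0 < n) :
    accordionVertex n k c p = accordionVertex n k c' p ↔ c ≡ c' [MOD 2 * (n / n.gcd k)] := by
  have hdiv : n ∣ k * (n / n.gcd k) := by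
    rw [← Nat.mul_div_assoc _ (Nat.gcd_dvd_left n k), mul_comm,
      Nat.mul_div_assoc _ (Nat.gcd_dvd_right n k)]
    exact dvd_mul_right _ _
  have hhalf : k * ((c + 1) / 2) ≡ k * ((c' + 1) / 2) [MOD n] ↔
      (c + 1) / 2 ≡ (c' + 1) / 2 [MOD n / n.gcd k] :=
    ⟨Nat.ModEq.cancel_left_div_gcd hn, fun h => (h.mul_left' k).of_dvd hdiv⟩
  have hadd : (p + 1 + k * ((c + 1) / 2) ≡ p + 1 + k * ((c' + 1) / 2) [MOD n]) ↔
      k * ((c + 1) / 2) ≡ k * ((c' + 1) / 2) [MOD n] :=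
    ⟨fun h => Nat.ModEq.add_left_cancel' _ h, fun h => h.add_left _⟩
  simp only [accordionVertex, Prod.mk.injEq]
  rw [ZMod.natCast_eq_natCast_iff, hadd, hhalf]
  set m := n / n.gcd k
  have hb := Nat.mod_two_of_bodd c
  have hb' := Nat.mod_two_of_bodd c'
  have hpar : c.bodd = c'.bodd ↔ c % 2 = c' % 2 := by
    rw [hb, hb']; cases c.bodd <;> cases c'.bodd <;> simp
  rw [hpar]
  constructor
  · rintro ⟨h1, h2⟩
    have h3 : 2 * ((c + 1) / 2) + (1 - c % 2) ≡ 2 * ((c' + 1) / 2) + (1 - c' % 2) [MOD 2 * m] := by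
      rw [h1]; exact (h2.mul_left' 2).add_right _
    rw [show 2 * ((c + 1) / 2) + (1 - c % 2) = c + 1 by omega,
      show 2 * ((c' + 1) / 2) + (1 - c' % 2) = c' + 1 by omega] at h3
    exact h3.add_right_cancel' 1
  · intro h
    have h1 : c % 2 = c' % 2 := h.of_mul_right m
    refine ⟨h1, Nat.ModEq.mul_left_cancel' (c := 2) two_ne_zero
      (Nat.ModEq.add_right_cancel' (c % 2) ?_)⟩
    have h3 : c + 2 * (c % 2) ≡ c' + 2 * (c' % 2) [MOD 2 * m] := by rw [h1]; exact h.add_right _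
    convert h3 using 1 <;> omega

lemma accordionVertex_column_eq {n k q c c' p p' : ℕ} (h : q ∣ n) (hk : q ∣ k)
    (hp : p < q) (hp' : p' < q)
    (heq : (accordionVertex n k c p).2 = (accordionVertex n k c' p').2) : p = p' := by
  have h1 := congrArg (ZMod.castHom h (ZMod q)) heq
  rw [castHom_accordionVertex h hk, castHom_accordionVertex h hk,
    ZMod.natCast_eq_natCast_iff] at h1
  exact (h1.add_right_cancel' 1).eq_of_lt_of_lt hp hp'

lemma accordionArc_accordionVertex_iff {n k : ℕ} (hn : 0 < n) {c c' p p' : ℕ}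
    (hp : p < n.gcd k) (hp' : p' < n.gcd k) :
    accordionArc n k (ZMod.castHom (Nat.gcd_dvd_left n k) (ZMod (n.gcd k)))
        (accordionVertex n k c p) (accordionVertex n k c' p') ↔
      (p' = p + 1 ∧ c ≡ c' [MOD 2 * (n / n.gcd k)]) ∨
      (p = p' ∧ c.bodd = false ∧ c' ≡ c + 1 [MOD 2 * (n / n.gcd k)]) ∨
      (p = p' ∧ c'.bodd = true ∧ c ≡ c' + 1 [MOD 2 * (n / n.gcd k)]) := by
  have hl := Nat.gcd_dvd_left n k
  have hr := Nat.gcd_dvd_right n k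
  rw [accordionArc, castHom_accordionVertex hl hr, Ne, ZMod.natCast_eq_zero_iff]
  constructor
  · rintro (⟨h1, h2, h3⟩ | ⟨h1, h2, h3 | h3⟩)
    · have hlt : p + 1 < n.gcd k :=
        lt_of_le_of_ne hp fun h => h3 (h ▸ dvd_rfl)
      have hs := accordionVertex_succ_right n k c p
      rw [← h2, h1] at hs
      have hpp := accordionVertex_column_eq hl hr hlt hp' (congrArg Prod.snd hs)
      subst hpp
      exact .inl ⟨rfl, (accordionVertex_eq_iff hn).1 hs⟩
    · have hpp := accordionVertex_column_eq hl hr hp hp' h3.symm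
      subst hpp
      have hs := accordionVertex_succ_left_of_odd h2
      rw [h3, ← h1] at hs
      exact .inr (.inr ⟨rfl, h2, ((accordionVertex_eq_iff hn).1 hs).symm⟩)
    · have hs := accordionVertex_succ_left_of_even h1
      rw [← h3, ← h2] at hs
      have hpp := accordionVertex_column_eq hl hr hp hp' (congrArg Prod.snd hs)
      subst hpp
      exact .inr (.inl ⟨rfl, h1, ((accordionVertex_eq_iff hn).1 hs).symm⟩)
  · rintro (⟨rfl, h⟩ | ⟨rfl, h1, h⟩ | ⟨rfl, h1, h⟩)
    · rw [← (accordionVertex_eq_iff hn).2 h, accordionVertex_succ_right]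
      exact .inl ⟨rfl, rfl, Nat.not_dvd_of_pos_of_lt p.succ_pos hp'⟩
    · rw [(accordionVertex_eq_iff hn).2 h, accordionVertex_succ_left_of_even h1]
      exact .inr ⟨h1, rfl, .inr rfl⟩
    · rw [(accordionVertex_eq_iff hn).2 h, accordionVertex_succ_left_of_odd h1]
      exact .inr ⟨rfl, h1, .inl rfl⟩

lemma bodd_eq_not_of_modEq_succ {m c c' : ℕ} (h : c ≡ c' + 1 [MOD 2 * m]) :
    c.bodd = !c'.bodd := by
  have h1 : c % 2 = (c' + 1) % 2 := h.of_mul_right m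
  rw [Nat.mod_two_of_bodd, Nat.mod_two_of_bodd, Nat.bodd_succ] at h1
  revert h1
  cases c.bodd <;> cases c'.bodd <;> simp

lemma accordionArc_or_iff {n k : ℕ} (hn : 0 < n) {c c' p p' : ℕ}
    (hp : p < n.gcd k) (hp' : p' < n.gcd k) :
    (accordionArc n k (ZMod.castHom (Nat.gcd_dvd_left n k) (ZMod (n.gcd k)))
        (accordionVertex n k c p) (accordionVertex n k c' p') ∨
      accordionArc n k (ZMod.castHom (Nat.gcd_dvd_left n k) (ZMod (n.gcd k)))
        (accordionVertex n k c' p') (accordionVertex n k c p)) ↔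
      ((c' ≡ c + 1 [MOD 2 * (n / n.gcd k)] ∨ c ≡ c' + 1 [MOD 2 * (n / n.gcd k)]) ∧ p = p') ∨
      ((p + 1 = p' ∨ p' + 1 = p) ∧ c ≡ c' [MOD 2 * (n / n.gcd k)]) := by
  rw [accordionArc_accordionVertex_iff hn hp hp', accordionArc_accordionVertex_iff hn hp' hp]
  have e1 := @bodd_eq_not_of_modEq_succ (n / n.gcd k) c c'
  have e2 := @bodd_eq_not_of_modEq_succ (n / n.gcd k) c' c
  have e3 : c ≡ c' [MOD 2 * (n / n.gcd k)] ↔ c' ≡ c [MOD 2 * (n / n.gcd k)] := Nat.ModEq.comm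
  rw [← e3, eq_comm (a := p') (b := p), eq_comm (a := p') (b := p + 1),
    eq_comm (a := p) (b := p' + 1)]
  cases hc : c.bodd <;> cases hc' : c'.bodd <;> simp [hc, hc'] at e1 e2 ⊢ <;> tauto

/-- For `n ≥ 3`, `0 < k ≤ n/2` and `q = gcd(n,k)`, deleting the edges
`{u_{tq} u_{tq+1}, v_{tq} v_{tq+1} : 1 ≤ t ≤ n/q}` from the accordion graph `A[n,k]`
yields a graph isomorphic to the Cartesian product `C_{2n/q} □ P_q`. -/
theorem accordion_deleteEdges_iso_boxProd (n k : ℕ) (hn : 3 ≤ n) (hk : 0 < k)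
    (hkn : 2 * k ≤ n) (q : ℕ) (hq : q = Nat.gcd n k) :
    Nonempty (((accordion n k).deleteEdges
        {e | ∃ t : ℕ, 1 ≤ t ∧ t ≤ n / q ∧
          (e = s(((false, ((t * q : ℕ) : ZMod n)) : Bool × ZMod n),
                 (false, ((t * q : ℕ) : ZMod n) + 1)) ∨
           e = s(((true, ((t * q : ℕ) : ZMod n)) : Bool × ZMod n),
                 (true, ((t * q : ℕ) : ZMod n) + 1)))})
      ≃g (SimpleGraph.cycleGraph (2 * n / q) □ SimpleGraph.pathGraph q)) := by
  subst hq
  have hn0 : 0 < n := by omega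
  have : NeZero n := ⟨hn0.ne'⟩
  have hl := Nat.gcd_dvd_left n k
  have hm : 0 < n / n.gcd k := Nat.div_pos (Nat.le_of_dvd hn0 hl) (Nat.gcd_pos_of_pos_left k hn0)
  have hN : 2 * n / n.gcd k = 2 * (n / n.gcd k) := Nat.mul_div_assoc 2 hl
  rw [hN]
  let f : Fin (2 * (n / n.gcd k)) × Fin (n.gcd k) → Bool × ZMod n :=
    fun x => accordionVertex n k x.1 x.2
  have hf : Function.Bijective f := by
    rw [Fintype.bijective_iff_injective_and_card]
    constructor
    · rintro ⟨c, p⟩ ⟨c', p'⟩ h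
      have hpp : p = p' := Fin.ext <| accordionVertex_column_eq hl (Nat.gcd_dvd_right n k)
        p.isLt p'.isLt (congrArg Prod.snd h)
      subst hpp
      have hcc : c = c' := Fin.ext <|
        ((accordionVertex_eq_iff hn0).1 h).eq_of_lt_of_lt c.isLt c'.isLt
      rw [hcc]
    · simp [ZMod.card, mul_assoc, Nat.div_mul_cancel hl]
  refine ⟨(RelIso.symm ⟨Equiv.ofBijective f hf, ?_⟩)⟩
  rintro ⟨c, p⟩ ⟨c', p'⟩
  have hcc : (c : ℕ) ≡ c' [MOD 2 * (n / n.gcd k)] ↔ c = c' :=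
    ⟨fun h => Fin.ext (h.eq_of_lt_of_lt c.isLt c'.isLt), fun h => h ▸ Nat.ModEq.refl _⟩
  rw [accordion_deleteEdges_adj hn hl, SimpleGraph.boxProd_adj, pathGraph_adj,
    cycleGraph_adj_iff_modEq (by omega), ← hcc, Fin.ext_iff]
  exact accordionArc_or_iff hn0 p.isLt p'.isLt
end

section
/- Let n ≥ 3 and let M be a perfect matching of the antiprism A_n = A[n,1]. Then M contains no diagonal spoke u_i v_{i+1} (i.e., M is a perfect matching of A_n − {u_i v_{i+1} : i ∈ [n]}) or M contains no vertical spoke u_i v_i (i.e., M is a perfect matching of A_n − {u_i v_i : i ∈ [n]}). -/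
open SimpleGraph

/-- Every neighbour of `u_{i+1}` in the antiprism is one of the four listed vertices. -/
theorem accordion_one_adj_false {n : ℕ} {i : ZMod n} {w : Bool × ZMod n}
    (h : (accordion n 1).Adj (false, i + 1) w) :
    w = (false, i) ∨ w = (false, i + 1 + 1) ∨ w = (true, i + 1) ∨ w = (true, i + 1 + 1) := by
  obtain ⟨b, j⟩ := w
  cases b <;> simp [accordion] at h ⊢ <;> grind

/-- Every neighbour of `v_{i+1}` in the antiprism is one of the four listed vertices. -/
theorem accordion_one_adj_true {n : ℕ} {i : ZMod n} {w : Bool × ZMod n}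
    (h : (accordion n 1).Adj (true, i + 1) w) :
    w = (true, i) ∨ w = (true, i + 1 + 1) ∨ w = (false, i + 1) ∨ w = (false, i) := by
  obtain ⟨b, j⟩ := w
  cases b <;> simp [accordion] at h ⊢ <;> grind

/-- A predicate on `ZMod n` that is invariant under adding `1` is constant. -/
theorem ZMod.iff_of_forall_iff_add_one {n : ℕ} {P : ZMod n → Prop}
    (h : ∀ i, P i ↔ P (i + 1)) (i j : ZMod n) : P i ↔ P j := by
  have key (k : ℤ) : P (i + k) ↔ P i := by
    induction k using Int.induction_on with
    | zero => simp
    | succ k ih => rw [← ih, h (i + (k : ℤ))]; push_cast; rw [add_assoc]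
    | pred k ih => rw [← ih, h (i + (-k - 1 : ℤ))]; push_cast; ring_nf
  obtain ⟨k, hk⟩ := ZMod.intCast_surjective (j - i)
  rw [← key k, hk, add_sub_cancel]

/-- For `n ≥ 3`, every perfect matching `M` of the antiprism `A_n = A[n,1]` contains
no diagonal spoke `u_i v_{i+1}`, or contains no vertical spoke `u_i v_i`. -/
theorem antiprism_perfectMatching_spokes (n : ℕ) (hn : 3 ≤ n)
    (M : (accordion n 1).Subgraph) (hM : M.IsPerfectMatching) :
    (∀ i : ZMod n, s(((false, i) : Bool × ZMod n), (true, i + 1)) ∉ M.edgeSet) ∨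
    (∀ i : ZMod n, s(((false, i) : Bool × ZMod n), (true, i)) ∉ M.edgeSet) := by
  have h2 : (1 : ZMod n) + 1 ≠ 0 := by
    intro h
    have : ((2 : ℕ) : ZMod n) = 0 := by push_cast; rw [← h]; norm_num
    exact absurd (Nat.le_of_dvd two_pos ((ZMod.natCast_eq_zero_iff 2 n).mp this)) (by omega)
  have hshift (i : ZMod n) : i ≠ i + 1 + 1 := fun h ↦ h2 (by linear_combination -h)
  have hshift_one (i : ZMod n) : i ≠ i + 1 := fun h ↦ h2 (by linear_combination -2 * h)
  have hex (v) : ∃ w, M.Adj v w := (hM.1 (hM.2 v)).exists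
  have huniq {v w w'} (h : M.Adj v w) (h' : M.Adj v w') : w = w' :=
    (hM.1 (hM.2 v)).unique h h'
  let A (i : ZMod n) : Prop := M.Adj (false, i) (false, i + 1)
  let B (i : ZMod n) : Prop := M.Adj (true, i) (true, i + 1)
  let S (i : ZMod n) : Prop := M.Adj (false, i) (true, i)
  let D (i : ZMod n) : Prop := M.Adj (false, i) (true, i + 1)
  have hu (i) : (A i ∨ A (i + 1) ∨ S (i + 1) ∨ D (i + 1)) ∧ ¬(A i ∧ A (i + 1)) ∧
      ¬(A i ∧ S (i + 1)) ∧ ¬(A i ∧ D (i + 1)) ∧ ¬(A (i + 1) ∧ S (i + 1)) ∧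
      ¬(A (i + 1) ∧ D (i + 1)) ∧ ¬(S (i + 1) ∧ D (i + 1)) := by
    refine ⟨?_, fun h ↦ ?_, fun h ↦ ?_, fun h ↦ ?_, fun h ↦ ?_, fun h ↦ ?_, fun h ↦ ?_⟩
    · obtain ⟨w, hw⟩ := hex (false, i + 1)
      rcases accordion_one_adj_false hw.adj_sub with rfl | rfl | rfl | rfl
      exacts [.inl hw.symm, .inr (.inl hw), .inr (.inr (.inl hw)), .inr (.inr (.inr hw))]
    · exact hshift i (congrArg Prod.snd (huniq h.1.symm h.2))
    · exact Bool.noConfusion (congrArg Prod.fst (huniq h.1.symm h.2))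
    · exact Bool.noConfusion (congrArg Prod.fst (huniq h.1.symm h.2))
    · exact Bool.noConfusion (congrArg Prod.fst (huniq h.1 h.2))
    · exact Bool.noConfusion (congrArg Prod.fst (huniq h.1 h.2))
    · exact hshift_one _ (congrArg Prod.snd (huniq h.1 h.2))
  have hv (i) : (B i ∨ B (i + 1) ∨ S (i + 1) ∨ D i) ∧ ¬(B i ∧ B (i + 1)) ∧
      ¬(B i ∧ S (i + 1)) ∧ ¬(B i ∧ D i) ∧ ¬(B (i + 1) ∧ S (i + 1)) ∧
      ¬(B (i + 1) ∧ D i) ∧ ¬(S (i + 1) ∧ D i) := by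
    refine ⟨?_, fun h ↦ ?_, fun h ↦ ?_, fun h ↦ ?_, fun h ↦ ?_, fun h ↦ ?_, fun h ↦ ?_⟩
    · obtain ⟨w, hw⟩ := hex (true, i + 1)
      rcases accordion_one_adj_true hw.adj_sub with rfl | rfl | rfl | rfl
      exacts [.inl hw.symm, .inr (.inl hw), .inr (.inr (.inl hw.symm)),
        .inr (.inr (.inr hw.symm))]
    · exact hshift i (congrArg Prod.snd (huniq h.1.symm h.2))
    · exact Bool.noConfusion (congrArg Prod.fst (huniq h.1.symm h.2.symm))
    · exact Bool.noConfusion (congrArg Prod.fst (huniq h.1.symm h.2.symm))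
    · exact Bool.noConfusion (congrArg Prod.fst (huniq h.1 h.2.symm))
    · exact Bool.noConfusion (congrArg Prod.fst (huniq h.1 h.2.symm))
    · exact hshift_one _ (congrArg Prod.snd (huniq h.1.symm h.2.symm)).symm
  -- In the cyclic order `…, v_i, u_i, v_{i+1}, u_{i+1}, …`, let `P i` say that an odd number
  -- of edges of `M` cross the gap between `u_i` and `v_{i+1}`.
  let P (i : ZMod n) : Prop := Xor (D i) (Xor (A i) (B i))
  have hP (i) : P i ↔ P (i + 1) := by
    have := hu i
    have := hv i
    simp only [P, Xor]
    clear_value A B S D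
    grind
  have hD (i) (h : D i) : P i := by
    have := hu (i - 1)
    have := hv i
    simp only [sub_add_cancel] at *
    simp only [P, Xor]
    clear_value A B S D
    grind
  have hS (i) (h : S (i + 1)) : ¬ P i := by
    have := hu i
    have := hv i
    simp only [P, Xor]
    clear_value A B S D
    grind
  by_contra! h
  obtain ⟨⟨i, hi⟩, j, hj⟩ := h
  have hSj : S (j - 1 + 1) := by rw [sub_add_cancel]; exact hj
  exact hS (j - 1) hSj ((ZMod.iff_of_forall_iff_add_one hP i (j - 1)).mp (hD i hi))
end
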